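/- arXiv:2603.20078 — 7 statements merged into one kernel-verified Lean document; each statement's English description precedes it below -/
import Mathlib

section
/- For every integer i ≥ 2, β_i = γ_{i,1} + Σ_{k=2}^∞ (−1)^k (λ^k β_k / k!) (γ_{i,1} − γ_{i,k}), the series converging absolutely. -/
open MeasureTheory

/-- Expansion of `u e^{-us} + e^{-u}` in powers of `u`. -/
theorem hasSum_neg_pow_div_factorial_mul (u s : ℝ) :
    HasSum (fun k : ℕ => (-u) ^ k / (k.factorial : ℝ) * (1 - k * s ^ (k - 1)))
      (u * Real.exp (-u * s) + Real.exp (-u)) := by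
  have hexp (v : ℝ) : HasSum (fun k : ℕ => v ^ k / (k.factorial : ℝ)) (Real.exp v) := by
    rw [Real.exp_eq_exp_ℝ]; exact NormedSpace.expSeries_div_hasSum_exp v
  have h : HasSum (fun k : ℕ => (-u) ^ k / (k.factorial : ℝ) * (k * s ^ (k - 1)))
      (-u * Real.exp (-u * s)) := by
    rw [← hasSum_nat_add_iff' 1]
    convert! (hexp (-u * s)).mul_left (-u) using 1
    · funext k
      rw [Nat.factorial_succ, mul_pow]
      push_cast
      have : (k.factorial : ℝ) ≠ 0 := by positivity
      field_simp
      ring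
    · simp
  convert! (hexp (-u)).sub h using 1
  · funext k; ring
  · ring

open Set Filter Topology in
/-- The `n`-th moment of the minimum of `k ≥ 1` independent copies of a variable with density `g`
is at most the `n`-th moment of the variable. -/
theorem integral_pow_mul_survival_le {g S : ℝ → ℝ} (hg : Integrable g) (hg0 : ∀ y, 0 ≤ g y)
    (hS : ∀ y, S y = 1 - ∫ t in (0:ℝ)..y, g t) (hS0 : ∀ y, 0 ≤ y → 0 ≤ S y)
    (hS1 : ∀ y, 0 ≤ y → S y ≤ 1) (hST : ∀ y, 0 ≤ y → S y = ∫ t in Ioi y, g t) {n : ℕ}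
    (hn : IntegrableOn (fun y => y ^ n * g y) (Ioi 0)) {k : ℕ} (hk : k ≠ 0)
    (hint : IntegrableOn (fun y => y ^ n * (k * S y ^ (k - 1) * g y)) (Ioi 0)) :
    ∫ y in Ioi (0:ℝ), y ^ n * (k * S y ^ (k - 1) * g y) ≤ ∫ y in Ioi (0:ℝ), y ^ n * g y := by
  refine le_of_tendsto (intervalIntegral_tendsto_integral_Ioi 0 hint tendsto_id) ?_
  filter_upwards [eventually_ge_atTop 0] with T hT
  have hTI : Ioc 0 T ⊆ Ioi 0 := Ioc_subset_Ioi_self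
  have hI1 : IntervalIntegrable (fun y => y ^ n * g y) volume 0 T :=
    (intervalIntegrable_iff_integrableOn_Ioc_of_le hT).2 (hn.mono_set hTI)
  have hI2 : IntervalIntegrable (fun y => y ^ n * (k * S y ^ (k - 1) * g y)) volume 0 T :=
    (intervalIntegrable_iff_integrableOn_Ioc_of_le hT).2 (hint.mono_set hTI)
  have hgI : IntervalIntegrable g volume 0 T := hg.intervalIntegrable
  have hpow {u : ℝ → ℝ} (hu : ContDiff ℝ 1 u) : AbsolutelyContinuousOnInterval u 0 T :=
    hu.contDiffOn.absolutelyContinuousOnInterval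
  have hSac : AbsolutelyContinuousOnInterval S 0 T := by
    have : S = fun y => 1 - ∫ t in (0:ℝ)..y, g t := funext hS
    rw [this]
    exact (hpow contDiff_const).fun_sub
      (hgI.absolutelyContinuousOnInterval_intervalIntegral left_mem_uIcc)
  have hSk (m : ℕ) : AbsolutelyContinuousOnInterval (fun y => S y ^ m) 0 T := by
    induction m with
    | zero => simpa using hpow (u := fun _ => 1) contDiff_const
    | succ m ih => simpa only [pow_succ] using! ih.mul hSac
  set H : ℝ → ℝ := fun y => y ^ n * (S y - S y ^ k) with hHdef
  have hH : AbsolutelyContinuousOnInterval H 0 T :=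
    (hpow (u := fun y => y ^ n) (contDiff_id.pow n)).mul (hSac.sub (hSk k))
  have hSS (y : ℝ) (hy : 0 ≤ y) : 0 ≤ S y - S y ^ k :=
    sub_nonneg.2 (pow_le_of_le_one (hS0 y hy) (hS1 y hy) hk)
  have hder : ∀ᵐ y, y ∈ Icc 0 T →
      y ^ n * (k * S y ^ (k - 1) * g y) - y ^ n * g y ≤ deriv H y := by
    filter_upwards [hgI.ae_hasDerivAt_integral] with y hy hyT
    rw [← uIcc_of_le hT] at hyT
    have hd : HasDerivAt S (-g y) y := by
      have := ((hy hyT 0 left_mem_uIcc).const_sub 1)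
      rwa [← funext hS] at this
    have hdH := (hasDerivAt_pow n y).mul (hd.sub (hd.pow k))
    rw [uIcc_of_le hT] at hyT
    have h1 : deriv H y = _ := hdH.deriv
    rw [h1]
    have h2 : 0 ≤ n * y ^ (n - 1) * (S y - S y ^ k) :=
      mul_nonneg (mul_nonneg n.cast_nonneg (pow_nonneg hyT.1 _)) (hSS y hyT.1)
    simp only [Pi.sub_apply, Pi.pow_apply]
    linarith
  have hle := intervalIntegral.integral_mono_ae_restrict hT (hI2.sub hI1)
    hH.intervalIntegrable_deriv ((ae_restrict_iff' measurableSet_Icc).2 hder)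
  rw [intervalIntegral.integral_sub hI2 hI1, hH.integral_deriv_eq_sub] at hle
  have hH0 : H 0 = 0 := by simp [hHdef, hS]
  have hHT : H T ≤ ∫ y in Ioi T, y ^ n * g y := by
    calc H T ≤ T ^ n * S T := by
          refine mul_le_mul_of_nonneg_left ?_ (pow_nonneg hT n)
          linarith [pow_nonneg (hS0 T hT) k]
      _ = ∫ y in Ioi T, T ^ n * g y := by rw [hST T hT, integral_const_mul]
      _ ≤ _ := by
          refine setIntegral_mono_on (hg.integrableOn.const_mul _)
            (hn.mono_set (Ioi_subset_Ioi hT)) measurableSet_Ioi fun y hy => ?_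
          have : T ≤ y := le_of_lt hy
          gcongr
          exact hg0 y
  rw [← intervalIntegral.integral_interval_add_Ioi hn (hn.mono_set (Ioi_subset_Ioi hT))]
  simp only [id]
  linarith

open Filter in
/-- Termwise integration, against an integrable weight `w`, of the expansion of
`u e^{-us} + e^{-u}` in powers of `u`. -/
theorem hasSum_integral_neg_pow_div_factorial_mul {α : Type*} [MeasurableSpace α] {μ : Measure α}
    {S w : α → ℝ} (hSm : AEStronglyMeasurable S μ) (hS : ∀ᵐ y ∂μ, 0 ≤ S y ∧ S y ≤ 1)
    (hw : Integrable w μ) (u : ℝ) :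
    HasSum (fun k : ℕ => (-u) ^ k / (k.factorial : ℝ) * ∫ y, (1 - k * S y ^ (k - 1)) * w y ∂μ)
      (∫ y, (u * Real.exp (-u * S y) + Real.exp (-u)) * w y ∂μ) := by
  have hbound (k : ℕ) : ∀ᵐ y ∂μ, ‖1 - k * S y ^ (k - 1)‖ ≤ 1 + k := by
    filter_upwards [hS] with y hy
    have h1 : S y ^ (k - 1) ≤ 1 := pow_le_one₀ hy.1 hy.2
    have h0 : 0 ≤ S y ^ (k - 1) := pow_nonneg hy.1 _
    have hk : (0:ℝ) ≤ k := k.cast_nonneg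
    rw [Real.norm_eq_abs, abs_le]
    constructor <;> nlinarith
  have hint (k : ℕ) : Integrable (fun y => (1 - k * S y ^ (k - 1)) * w y) μ :=
    hw.bdd_mul (by fun_prop) (hbound k)
  have hsum : Summable fun k : ℕ => |u| ^ k / (k.factorial : ℝ) * ((1 + k) * ∫ y, ‖w y‖ ∂μ) := by
    have h := ((Real.summable_pow_div_factorial |u|).mul_left 2).sub
      (hasSum_neg_pow_div_factorial_mul (-|u|) 1).summable
    convert! h.mul_right (∫ y, ‖w y‖ ∂μ) using 1
    funext k
    rw [neg_neg, one_pow]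
    ring
  have h := hasSum_integral_of_summable_integral_norm
    (F := fun (k : ℕ) y => (-u) ^ k / (k.factorial : ℝ) * ((1 - k * S y ^ (k - 1)) * w y))
    (fun k => (hint k).const_mul _) ?_
  · simp only [integral_const_mul] at h
    convert! h using 1
    refine integral_congr_ae (Eventually.of_forall fun y => ?_)
    simp only [← mul_assoc]
    exact ((hasSum_neg_pow_div_factorial_mul u (S y)).mul_right (w y)).tsum_eq.symm
  · refine hsum.of_nonneg_of_le (fun k => integral_nonneg fun y => norm_nonneg _) fun k => ?_
    simp only [norm_mul, norm_div, norm_pow, norm_neg, integral_const_mul,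
      Real.norm_eq_abs, Nat.abs_cast]
    refine mul_le_mul_of_nonneg_left ?_ (by positivity)
    rw [← integral_const_mul]
    refine integral_mono_ae (by simpa [abs_mul] using (hint k).norm)
      (hw.norm.const_mul _) ?_
    filter_upwards [hbound k] with y hy
    exact mul_le_mul_of_nonneg_right hy (abs_nonneg _)

open Filter in
/-- Termwise integration of a power series in `lam * x` with coefficients `O(1 / k!)` against a
weight with an exponential moment of order `lam`. -/
theorem hasSum_integral_mul_tsum_neg_pow_div_factorial {μ : Measure ℝ} {lam : ℝ} (hlam : 0 ≤ lam)
    (hμ : ∀ᵐ x ∂μ, 0 ≤ x) {f : ℝ → ℝ} (hf : ∀ x, 0 ≤ f x)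
    (hint : ∀ n : ℕ, Integrable (fun x => x ^ n * f x) μ)
    (hexp : Integrable (fun x => Real.exp (lam * x) * f x) μ)
    {c : ℕ → ℝ} {C : ℝ} (hc : ∀ k, |c k| ≤ C) :
    (Summable fun k : ℕ =>
      |(-1) ^ k * lam ^ k * (∫ x, x ^ k * f x ∂μ) / (k.factorial : ℝ) * c k|) ∧
    HasSum (fun k : ℕ => (-1) ^ k * lam ^ k * (∫ x, x ^ k * f x ∂μ) / (k.factorial : ℝ) * c k)
      (∫ x, f x * ∑' k : ℕ, (-(lam * x)) ^ k / (k.factorial : ℝ) * c k ∂μ) := by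
  have hβ (k : ℕ) : 0 ≤ ∫ x, x ^ k * f x ∂μ :=
    integral_nonneg_of_ae (by
      filter_upwards [hμ] with x hx
      exact mul_nonneg (pow_nonneg hx k) (hf x))
  have hsum : Summable fun k : ℕ => lam ^ k / (k.factorial : ℝ) * ∫ x, x ^ k * f x ∂μ := by
    refine summable_of_sum_range_le (c := ∫ x, Real.exp (lam * x) * f x ∂μ)
      (fun k => mul_nonneg (by positivity) (hβ k)) fun n => ?_
    simp only [← integral_const_mul]
    rw [← integral_finsetSum _ fun k _ => (hint k).const_mul _]
    refine integral_mono_ae (integrable_finsetSum _ fun k _ => (hint k).const_mul _) hexp ?_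
    filter_upwards [hμ] with x hx
    calc ∑ k ∈ Finset.range n, lam ^ k / (k.factorial : ℝ) * (x ^ k * f x)
        = (∑ k ∈ Finset.range n, (lam * x) ^ k / (k.factorial : ℝ)) * f x := by
          rw [Finset.sum_mul]
          exact Finset.sum_congr rfl fun k _ => by rw [mul_pow]; ring
      _ ≤ _ := mul_le_mul_of_nonneg_right
          (Real.sum_le_exp_of_nonneg (mul_nonneg hlam hx) n) (hf x)
  have habs : Summable fun k : ℕ =>
      lam ^ k / (k.factorial : ℝ) * (∫ x, x ^ k * f x ∂μ) * |c k| :=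
    (hsum.mul_right C).of_nonneg_of_le
      (fun k => mul_nonneg (mul_nonneg (by positivity) (hβ k)) (abs_nonneg _))
      (fun k => mul_le_mul_of_nonneg_left (hc k) (mul_nonneg (by positivity) (hβ k)))
  constructor
  · convert! habs using 2 with k
    rw [abs_mul, abs_div, abs_mul, abs_mul, abs_pow, abs_neg, abs_one, one_pow,
      abs_of_nonneg (hβ k), Nat.abs_cast, abs_of_nonneg (pow_nonneg hlam k)]
    ring
  · have h := hasSum_integral_of_summable_integral_norm (μ := μ)
      (F := fun (k : ℕ) x => ((-1) ^ k * lam ^ k / (k.factorial : ℝ) * c k) * (x ^ k * f x))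
      (fun k => (hint k).const_mul _) ?_
    · simp only [integral_const_mul] at h
      convert! h using 1
      · funext k; ring
      · refine integral_congr_ae (Eventually.of_forall fun x => ?_)
        simp only [← tsum_mul_left]
        refine tsum_congr fun k => ?_
        rw [neg_pow, mul_pow]
        ring
    · convert! habs using 2 with k
      simp only [norm_mul _ (_ * _), integral_const_mul]
      rw [norm_mul, norm_div, norm_mul, norm_pow, norm_pow, norm_neg, norm_one, one_pow,
        Real.norm_of_nonneg hlam, Real.norm_natCast, Real.norm_eq_abs]
      have : ∫ x, ‖x ^ k * f x‖ ∂μ = ∫ x, x ^ k * f x ∂μ := integral_congr_ae (by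
        filter_upwards [hμ] with x hx
        exact Real.norm_of_nonneg (mul_nonneg (pow_nonneg hx k) (hf x)))
      rw [this]
      ring

/-- For every integer `i ≥ 2`,
`β_i = γ_{i,1} + Σ_{k=2}^∞ (−1)^k (λ^k β_k / k!) (γ_{i,1} − γ_{i,k})`,
the series converging absolutely. -/
theorem stmt_2
    (lam : ℝ) (hlam : 0 < lam)
    (g : ℝ → ℝ) (hg_meas : Measurable g) (hg_nonneg : ∀ y, 0 ≤ g y)
    (hg_supp : ∀ y, y < 0 → g y = 0)
    (hg_prob : ∫ y in Set.Ioi (0:ℝ), g y = 1)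
    (hg_mom : ∀ n : ℕ, IntegrableOn (fun y => y ^ n * g y) (Set.Ioi 0))
    (G : ℝ → ℝ) (hG : ∀ y, G y = ∫ t in (0:ℝ)..y, g t)
    (γ : ℕ → ℕ → ℝ)
    (hγ : ∀ n j : ℕ, γ n j = ∫ y in Set.Ioi (0:ℝ), y ^ n * j * (1 - G y) ^ (j - 1) * g y)
    (f : ℝ → ℝ) (hf_meas : Measurable f) (hf_nonneg : ∀ y, 0 ≤ f y)
    (hf_supp : ∀ y, y < 0 → f y = 0)
    (hf_prob : ∫ y in Set.Ioi (0:ℝ), f y = 1)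
    (β : ℕ → ℝ) (hβ : ∀ n : ℕ, β n = ∫ x in Set.Ioi (0:ℝ), x ^ n * f x)
    (hβ_fin : ∀ n : ℕ, IntegrableOn (fun x => x ^ n * f x) (Set.Ioi 0))
    (hexp : IntegrableOn (fun x => Real.exp (lam * x) * f x) (Set.Ioi 0))
    (hinv : ∀ᵐ y ∂(volume.restrict (Set.Ici (0:ℝ))),
      f y = ∫ x in Set.Ioi (0:ℝ),
        f x * ((lam * x * Real.exp (-(lam * x) * (1 - G y)) + Real.exp (-(lam * x))) * g y)) :
    ∀ i : ℕ, 2 ≤ i →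
      Summable (fun k : ℕ =>
        |(-1:ℝ) ^ (k+2) * lam ^ (k+2) * β (k+2) / ((k+2).factorial : ℝ) *
          (γ i 1 - γ i (k+2))|) ∧
      β i = γ i 1 + ∑' k : ℕ,
        (-1:ℝ) ^ (k+2) * lam ^ (k+2) * β (k+2) / ((k+2).factorial : ℝ) *
          (γ i 1 - γ i (k+2)) := by
  intro i _
  have hgI : Integrable g := by
    have h0 : IntegrableOn g (Set.Ici 0) :=
      (integrableOn_Ici_iff_integrableOn_Ioi (by simp)).2 (by simpa using hg_mom 0)
    refine (integrableOn_iff_integrable_of_support_subset fun y hy => ?_).1 h0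
    by_contra h
    exact hy (hg_supp y (not_le.1 h))
  set S : ℝ → ℝ := fun y => 1 - G y with hSdef
  have hS (y : ℝ) : S y = 1 - ∫ t in (0:ℝ)..y, g t := by simp only [hSdef, hG]
  have hST (y : ℝ) (_ : 0 ≤ y) : S y = ∫ t in Set.Ioi y, g t := by
    rw [hS, ← hg_prob,
      ← intervalIntegral.integral_interval_add_Ioi hgI.integrableOn (b := y) hgI.integrableOn]
    ring
  have hS0 (y : ℝ) (hy : 0 ≤ y) : 0 ≤ S y :=
    hST y hy ▸ integral_nonneg hg_nonneg
  have hS1 (y : ℝ) (hy : 0 ≤ y) : S y ≤ 1 := by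
    rw [hS]
    linarith [intervalIntegral.integral_nonneg hy (μ := volume) fun t _ => hg_nonneg t]
  have hSc : Continuous S := by
    rw [funext hS]
    exact continuous_const.sub (intervalIntegral.continuous_primitive
      (fun _ _ => hgI.intervalIntegrable) 0)
  set μ : Measure ℝ := volume.restrict (Set.Ioi 0)
  have hμ : ∀ᵐ y ∂μ, 0 ≤ y := by
    filter_upwards [ae_restrict_mem measurableSet_Ioi] with y hy using le_of_lt hy
  have hSμ : ∀ᵐ y ∂μ, 0 ≤ S y ∧ S y ≤ 1 := by
    filter_upwards [hμ] with y hy using ⟨hS0 y hy, hS1 y hy⟩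
  have hw : Integrable (fun y => y ^ i * g y) μ := hg_mom i
  have hγint (k : ℕ) : Integrable (fun y => y ^ i * (k * S y ^ (k - 1) * g y)) μ := by
    have : Integrable (fun y => (k * S y ^ (k - 1)) * (y ^ i * g y)) μ := by
      refine hw.bdd_mul (c := k) (by fun_prop) ?_
      filter_upwards [hSμ] with y hy
      rw [norm_mul, Real.norm_natCast, Real.norm_of_nonneg (pow_nonneg hy.1 _)]
      exact mul_le_of_le_one_right k.cast_nonneg (pow_le_one₀ hy.1 hy.2)
    convert! this using 2 with y
    ring
  have hγ' (k : ℕ) : γ i k = ∫ y, y ^ i * (k * S y ^ (k - 1) * g y) ∂μ := by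
    rw [hγ]
    congr with y
    ring
  have hγ1 : γ i 1 = ∫ y, y ^ i * g y ∂μ := by rw [hγ']; simp
  have hγ0 : γ i 0 = 0 := by rw [hγ']; simp
  have hγ_nonneg (k : ℕ) : 0 ≤ γ i k := by
    rw [hγ']
    refine integral_nonneg_of_ae ?_
    filter_upwards [hμ] with y hy
    have := hS0 y hy
    have := hg_nonneg y
    simp only [Pi.zero_apply]
    positivity
  have hγ_le (k : ℕ) : γ i k ≤ γ i 1 := by
    rcases eq_or_ne k 0 with rfl | hk
    · exact hγ0 ▸ hγ_nonneg 1
    · rw [hγ1, hγ']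
      exact integral_pow_mul_survival_le hgI hg_nonneg hS hS0 hS1 hST hw hk (hγint k)
  have hc (k : ℕ) : |γ i 1 - γ i k| ≤ γ i 1 := by
    rw [abs_of_nonneg (sub_nonneg.2 (hγ_le k))]
    linarith [hγ_nonneg k]
  obtain ⟨hsum, hhas⟩ :=
    hasSum_integral_mul_tsum_neg_pow_div_factorial hlam.le hμ hf_nonneg hβ_fin hexp hc
  simp only [← hβ] at hsum hhas
  have hinner (x : ℝ) : ∑' k : ℕ, (-(lam * x)) ^ k / (k.factorial : ℝ) * (γ i 1 - γ i k) =
      ∫ y, (lam * x * Real.exp (-(lam * x) * S y) + Real.exp (-(lam * x))) * (y ^ i * g y) ∂μ := by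
    rw [← (hasSum_integral_neg_pow_div_factorial_mul hSc.aestronglyMeasurable hSμ hw
      (lam * x)).tsum_eq]
    refine tsum_congr fun k => ?_
    rw [hγ1, hγ', ← integral_sub hw (hγint k)]
    congr 2 with y
    ring
  have hprod : Integrable (Function.uncurry fun y x => f x *
      ((lam * x * Real.exp (-(lam * x) * S y) + Real.exp (-(lam * x))) * (y ^ i * g y)))
      (μ.prod μ) := by
    have hf1 : Integrable (fun x => lam * (x ^ 1 * f x) + x ^ 0 * f x) μ :=
      ((hβ_fin 1).const_mul lam).add (hβ_fin 0)
    refine (hw.mul_prod hf1).mono' ?_ ?_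
    · have := hSc.measurable
      exact Measurable.aestronglyMeasurable (by unfold Function.uncurry; fun_prop)
    · have hy := Measure.quasiMeasurePreserving_fst (μ := μ) (ν := μ) |>.ae hμ
      have hx := Measure.quasiMeasurePreserving_snd (μ := μ) (ν := μ) |>.ae hμ
      filter_upwards [hy, hx] with ⟨y, x⟩ (hy : 0 ≤ y) (hx : 0 ≤ x)
      have hux : 0 ≤ lam * x := mul_nonneg hlam.le hx
      have h0 := hS0 y hy
      have h1 := hg_nonneg y
      have h2 := hf_nonneg x
      have h3 : Real.exp (-(lam * x) * S y) ≤ 1 :=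
        Real.exp_le_one_iff.2 (by nlinarith)
      have h4 : Real.exp (-(lam * x)) ≤ 1 := Real.exp_le_one_iff.2 (by linarith)
      simp only [Function.uncurry_apply_pair]
      rw [Real.norm_of_nonneg (by positivity)]
      calc f x * ((lam * x * Real.exp (-(lam * x) * S y) + Real.exp (-(lam * x))) * (y ^ i * g y))
          ≤ f x * ((lam * x * 1 + 1) * (y ^ i * g y)) := by gcongr
        _ = _ := by ring
  have hβi : β i = ∫ x, f x * ∑' k : ℕ, (-(lam * x)) ^ k / (k.factorial : ℝ) *
      (γ i 1 - γ i k) ∂μ := by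
    simp only [hinner, ← integral_const_mul]
    rw [← integral_integral_swap hprod, hβ]
    refine integral_congr_ae ?_
    filter_upwards [ae_restrict_of_ae_restrict_of_subset Set.Ioi_subset_Ici_self hinv] with y hy
    rw [hy, ← integral_const_mul]
    congr with x
    ring
  have hβ0 : β 0 = 1 := by simpa [hβ] using hf_prob
  rw [← hβi, ← hasSum_nat_add_iff' 2] at hhas
  refine ⟨(summable_nat_add_iff 2).2 hsum, ?_⟩
  rw [hhas.tsum_eq]
  simp [Finset.sum_range_succ, hβ0, hγ0]
end

section
/- The first moment of the invariant density satisfies β₁ = γ_{1,1} + Σ_{k=2}^∞ (−1)^k (λ^k β_k / k!) (γ_{1,1} − γ_{1,k}), the series converging absolutely. -/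
open MeasureTheory

/-- Constant functions are absolutely continuous. -/
theorem AbsolutelyContinuousOnInterval.fun_const (c a b : ℝ) :
    AbsolutelyContinuousOnInterval (fun _ : ℝ => c) a b :=
  (contDiffOn_const (n := 1)).absolutelyContinuousOnInterval

/-- Natural powers of absolutely continuous functions are absolutely continuous. -/
theorem AbsolutelyContinuousOnInterval.fun_pow {u : ℝ → ℝ} {a b : ℝ}
    (hu : AbsolutelyContinuousOnInterval u a b) (n : ℕ) :
    AbsolutelyContinuousOnInterval (fun x => u x ^ n) a b := by
  induction n with
  | zero => simpa using AbsolutelyContinuousOnInterval.fun_const 1 a b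
  | succ n ih => simpa only [pow_succ] using ih.fun_mul hu

/-- The survival function of a density on `(0, ∞)` is its tail integral. -/
theorem one_sub_integral_eq_tail {g : ℝ → ℝ} (hg : Integrable g)
    (hg_prob : ∫ y in Set.Ioi (0:ℝ), g y = 1) (y : ℝ) :
    1 - ∫ t in (0:ℝ)..y, g t = ∫ t in Set.Ioi y, g t := by
  rw [← hg_prob]
  have := intervalIntegral.integral_Ioi_sub_Ioi' (a := 0) (b := y) hg.integrableOn hg.integrableOn
  linarith

theorem one_sub_integral_nonneg {g : ℝ → ℝ} (hg : Integrable g) (hg_nonneg : ∀ y, 0 ≤ g y)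
    (hg_prob : ∫ y in Set.Ioi (0:ℝ), g y = 1) (y : ℝ) :
    0 ≤ 1 - ∫ t in (0:ℝ)..y, g t := by
  rw [one_sub_integral_eq_tail hg hg_prob]
  exact setIntegral_nonneg measurableSet_Ioi fun t _ => hg_nonneg t

theorem one_sub_integral_le_one {g : ℝ → ℝ} (hg_nonneg : ∀ y, 0 ≤ g y) {y : ℝ} (hy : 0 ≤ y) :
    1 - ∫ t in (0:ℝ)..y, g t ≤ 1 := by
  have := intervalIntegral.integral_nonneg (μ := volume) hy fun t _ => hg_nonneg t
  linarith

theorem continuous_one_sub_integral {g : ℝ → ℝ} (hg : Integrable g) :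
    Continuous fun y => 1 - ∫ t in (0:ℝ)..y, g t :=
  continuous_const.sub (intervalIntegral.continuous_primitive (fun _ _ => hg.intervalIntegrable) 0)

/-- Markov's inequality for a density on `(0, ∞)`. -/
theorem mul_one_sub_integral_le {g : ℝ → ℝ} (hg : Integrable g) (hg_nonneg : ∀ y, 0 ≤ g y)
    (hg_prob : ∫ y in Set.Ioi (0:ℝ), g y = 1)
    (hmom : IntegrableOn (fun y => y * g y) (Set.Ioi 0))
    {b : ℝ} (hb : 0 ≤ b) :
    b * (1 - ∫ t in (0:ℝ)..b, g t) ≤ ∫ y in Set.Ioi (0:ℝ), y * g y := by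
  rw [one_sub_integral_eq_tail hg hg_prob, ← integral_const_mul]
  have hsub : Set.Ioi b ⊆ Set.Ioi (0:ℝ) := Set.Ioi_subset_Ioi hb
  calc ∫ t in Set.Ioi b, b * g t ≤ ∫ t in Set.Ioi b, t * g t :=
        setIntegral_mono_on (hg.integrableOn.const_mul b) (hmom.mono_set hsub) measurableSet_Ioi
          fun t ht => mul_le_mul_of_nonneg_right (le_of_lt ht) (hg_nonneg t)
    _ ≤ ∫ t in Set.Ioi (0:ℝ), t * g t :=
        setIntegral_mono_set hmom
          ((ae_restrict_iff' measurableSet_Ioi).2 <| .of_forall fun t ht =>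
            mul_nonneg (le_of_lt ht) (hg_nonneg t)) hsub.eventuallyLE

/-- The truncated first moment of the minimum of `n + 1` i.i.d. copies is at most twice the
first moment of a single copy. -/
theorem intervalIntegral_minimum_moment_le {g : ℝ → ℝ} (hg : Integrable g)
    (hg_nonneg : ∀ y, 0 ≤ g y)
    (hg_prob : ∫ y in Set.Ioi (0:ℝ), g y = 1)
    (hmom : IntegrableOn (fun y => y * g y) (Set.Ioi 0)) (n : ℕ) {b : ℝ} (hb : 0 ≤ b) :
    ∫ y in (0:ℝ)..b, y * ((n + 1) * (1 - ∫ t in (0:ℝ)..y, g t) ^ n) * g y ≤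
      2 * ∫ y in Set.Ioi (0:ℝ), y * g y := by
  set S : ℝ → ℝ := fun y => 1 - ∫ t in (0:ℝ)..y, g t with hS
  have hS0 (y) : 0 ≤ S y := one_sub_integral_nonneg hg hg_nonneg hg_prob y
  have hS1 {y} (hy : 0 ≤ y) : S y ≤ 1 := one_sub_integral_le_one hg_nonneg hy
  have hScont : Continuous S := continuous_one_sub_integral hg
  have hSac : AbsolutelyContinuousOnInterval S 0 b :=
    (AbsolutelyContinuousOnInterval.fun_const 1 0 b).fun_sub
      (hg.intervalIntegrable.absolutelyContinuousOnInterval_intervalIntegral (by simp))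
  have hid : AbsolutelyContinuousOnInterval (fun y : ℝ => y) 0 b :=
    (contDiffOn_id (n := 1)).absolutelyContinuousOnInterval
  have hac : AbsolutelyContinuousOnInterval (fun y => y * (S y - S y ^ (n + 1))) 0 b :=
    hid.fun_mul (hSac.fun_sub (hSac.fun_pow (n + 1)))
  have hderiv : ∀ᵐ y, deriv (fun y => y * (S y - S y ^ (n + 1))) y =
      (S y - S y ^ (n + 1)) + (y * ((n + 1) * S y ^ n) * g y - y * g y) := by
    filter_upwards [LocallyIntegrable.ae_hasDerivAt_integral hg.locallyIntegrable] with y hy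
    have h1 : HasDerivAt S (-g y) y := (hy 0).const_sub 1
    have h2 := (hasDerivAt_id y).mul (h1.sub (h1.pow (n + 1)))
    refine (h2.congr_deriv ?_).deriv
    simp
    ring
  have hi1 : IntervalIntegrable (fun y => S y - S y ^ (n + 1)) volume 0 b :=
    (hScont.sub (hScont.pow _)).intervalIntegrable _ _
  have hi2 : IntervalIntegrable (fun y => y * ((n + 1) * S y ^ n) * g y) volume 0 b :=
    hg.intervalIntegrable.continuousOn_mul (by fun_prop)
  have hi3 : IntervalIntegrable (fun y => y * g y) volume 0 b :=
    hg.intervalIntegrable.continuousOn_mul (by fun_prop)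
  have key := hac.integral_deriv_eq_sub
  rw [intervalIntegral.integral_congr_ae (hderiv.mono fun y hy _ => hy),
    intervalIntegral.integral_add hi1 (hi2.sub hi3), intervalIntegral.integral_sub hi2 hi3] at key
  have hD : 0 ≤ ∫ y in (0:ℝ)..b, S y - S y ^ (n + 1) :=
    intervalIntegral.integral_nonneg hb fun y hy =>
      sub_nonneg.2 (pow_le_of_le_one (hS0 y) (hS1 hy.1) n.succ_ne_zero)
  have hM : b * S b ≤ ∫ y in Set.Ioi (0:ℝ), y * g y :=
    mul_one_sub_integral_le hg hg_nonneg hg_prob hmom hb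
  have hT : ∫ y in (0:ℝ)..b, y * g y ≤ ∫ y in Set.Ioi (0:ℝ), y * g y := by
    rw [intervalIntegral.integral_of_le hb]
    exact setIntegral_mono_set hmom
      ((ae_restrict_iff' measurableSet_Ioi).2 <| .of_forall fun t ht =>
        mul_nonneg (le_of_lt ht) (hg_nonneg t)) Set.Ioc_subset_Ioi_self.eventuallyLE
  have hP : 0 ≤ b * S b ^ (n + 1) := mul_nonneg hb (pow_nonneg (hS0 b) _)
  nlinarith

theorem integrableOn_mul_minimum_density {g : ℝ → ℝ} (hg : Integrable g) (hg_nonneg : ∀ y, 0 ≤ g y)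
    (hg_prob : ∫ y in Set.Ioi (0:ℝ), g y = 1)
    (hmom : IntegrableOn (fun y => y * g y) (Set.Ioi 0)) (n : ℕ) :
    IntegrableOn (fun y => y * ((n + 1) * (1 - ∫ t in (0:ℝ)..y, g t) ^ n) * g y) (Set.Ioi 0) := by
  have hS := continuous_one_sub_integral hg
  have hc : Continuous fun y => ((n:ℝ) + 1) * (1 - ∫ t in (0:ℝ)..y, g t) ^ n := by fun_prop
  refine (hmom.bdd_mul (c := (n:ℝ) + 1) hc.aestronglyMeasurable ?_).congr
    (.of_forall fun y => by ring)
  filter_upwards [ae_restrict_mem measurableSet_Ioi] with y hy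
  have h0 := one_sub_integral_nonneg hg hg_nonneg hg_prob y
  rw [Real.norm_of_nonneg (by positivity)]
  exact mul_le_of_le_one_right (by positivity)
    (pow_le_one₀ h0 (one_sub_integral_le_one hg_nonneg (le_of_lt hy)))

/-- The first moment of the minimum of `n + 1` i.i.d. copies is at most twice the first moment of
a single copy. -/
theorem integral_minimum_moment_le {g : ℝ → ℝ} (hg : Integrable g) (hg_nonneg : ∀ y, 0 ≤ g y)
    (hg_prob : ∫ y in Set.Ioi (0:ℝ), g y = 1)
    (hmom : IntegrableOn (fun y => y * g y) (Set.Ioi 0)) (n : ℕ) :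
    ∫ y in Set.Ioi (0:ℝ), y * ((n + 1) * (1 - ∫ t in (0:ℝ)..y, g t) ^ n) * g y ≤
      2 * ∫ y in Set.Ioi (0:ℝ), y * g y := by
  have hint := integrableOn_mul_minimum_density hg hg_nonneg hg_prob hmom n
  refine le_of_tendsto (intervalIntegral_tendsto_integral_Ioi 0 hint Filter.tendsto_id) ?_
  filter_upwards [Filter.eventually_ge_atTop 0] with b hb
  exact intervalIntegral_minimum_moment_le hg hg_nonneg hg_prob hmom n hb

/-- An exponential moment dominates the exponential series of the moments. -/
theorem summable_pow_div_factorial_mul_integral_pow {f : ℝ → ℝ} {a : ℝ} (ha : 0 ≤ a)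
    (hf_nonneg : ∀ x, 0 ≤ f x)
    (hmom : ∀ n : ℕ, IntegrableOn (fun x => x ^ n * f x) (Set.Ioi 0))
    (hexp : IntegrableOn (fun x => Real.exp (a * x) * f x) (Set.Ioi 0)) :
    Summable fun k : ℕ => a ^ k / k.factorial * ∫ x in Set.Ioi (0:ℝ), x ^ k * f x := by
  refine summable_of_sum_le (c := ∫ x in Set.Ioi (0:ℝ), Real.exp (a * x) * f x) (fun k =>
    mul_nonneg (by positivity) (setIntegral_nonneg measurableSet_Ioi fun x hx =>
      mul_nonneg (pow_nonneg (le_of_lt hx) k) (hf_nonneg x))) fun s => ?_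
  simp_rw [← integral_const_mul]
  rw [← integral_finsetSum _ fun k _ => (hmom k).const_mul _]
  refine setIntegral_mono_on (integrable_finsetSum _ fun k _ => (hmom k).const_mul _) hexp
    measurableSet_Ioi fun x hx => ?_
  have hx0 : 0 ≤ x := le_of_lt hx
  have hsum : HasSum (fun k : ℕ => (a * x) ^ k / k.factorial) (Real.exp (a * x)) := by
    rw [Real.exp_eq_exp_ℝ]
    exact NormedSpace.expSeries_div_hasSum_exp (a * x)
  calc ∑ k ∈ s, a ^ k / k.factorial * (x ^ k * f x)
      = (∑ k ∈ s, (a * x) ^ k / k.factorial) * f x := by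
        rw [Finset.sum_mul]
        exact Finset.sum_congr rfl fun k _ => by rw [mul_pow]; ring
    _ ≤ Real.exp (a * x) * f x :=
        mul_le_mul_of_nonneg_right (sum_le_hasSum s (fun k _ => by positivity) hsum) (hf_nonneg x)

/-- The power series of the stage-length transition kernel of the gated M/G/∞ queue. -/
theorem hasSum_gated_kernel (a s : ℝ) :
    HasSum (fun k : ℕ => (-a) ^ k / k.factorial * (1 - k * s ^ (k - 1)))
      (a * Real.exp (-a * s) + Real.exp (-a)) := by
  have hexp (x : ℝ) : HasSum (fun k : ℕ => x ^ k / k.factorial) (Real.exp x) := by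
    rw [Real.exp_eq_exp_ℝ]
    exact NormedSpace.expSeries_div_hasSum_exp x
  have h2 : HasSum (fun k : ℕ => (-a) ^ k / k.factorial * (k * s ^ (k - 1)))
      (-a * Real.exp (-a * s)) := by
    rw [← hasSum_nat_add_iff' 1]
    simp only [Finset.sum_range_one, CharP.cast_eq_zero, zero_mul, mul_zero, sub_zero]
    refine ((hexp (-a * s)).mul_left (-a)).congr_fun fun k => ?_
    rw [Nat.factorial_succ, Nat.add_sub_cancel]
    push_cast
    field_simp
    ring
  rw [show a * Real.exp (-a * s) + Real.exp (-a) = Real.exp (-a) - -a * Real.exp (-a * s) by ring]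
  exact ((hexp (-a)).sub h2).congr_fun fun k => by ring

/-- A density on `(0, ∞)` which vanishes on the negative half line is integrable. -/
theorem integrable_of_setIntegral_Ioi_eq_one {g : ℝ → ℝ} (hg_supp : ∀ y, y < 0 → g y = 0)
    (hg_prob : ∫ y in Set.Ioi (0:ℝ), g y = 1) : Integrable g := by
  have h : IntegrableOn g (Set.Ici 0) := by
    rw [integrableOn_Ici_iff_integrableOn_Ioi]
    by_contra h
    rw [integral_undef h] at hg_prob
    exact zero_ne_one hg_prob
  refine (integrableOn_iff_integrable_of_support_subset fun y hy => ?_).1 h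
  by_contra hy'
  exact hy (hg_supp y (not_le.1 hy'))



/-- The first moment of the invariant density satisfies
`β₁ = γ_{1,1} + Σ_{k=2}^∞ (−1)^k (λ^k β_k / k!) (γ_{1,1} − γ_{1,k})`,
the series converging absolutely. -/
theorem stmt_4
    (lam : ℝ) (hlam : 0 < lam)
    (g : ℝ → ℝ) (hg_meas : Measurable g) (hg_nonneg : ∀ y, 0 ≤ g y)
    (hg_supp : ∀ y, y < 0 → g y = 0)
    (hg_prob : ∫ y in Set.Ioi (0:ℝ), g y = 1)
    (hg_mom : ∀ n : ℕ, IntegrableOn (fun y => y ^ n * g y) (Set.Ioi 0))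
    (G : ℝ → ℝ) (hG : ∀ y, G y = ∫ t in (0:ℝ)..y, g t)
    (γ : ℕ → ℕ → ℝ)
    (hγ : ∀ n j : ℕ, γ n j = ∫ y in Set.Ioi (0:ℝ), y ^ n * j * (1 - G y) ^ (j - 1) * g y)
    (f : ℝ → ℝ) (hf_meas : Measurable f) (hf_nonneg : ∀ y, 0 ≤ f y)
    (hf_supp : ∀ y, y < 0 → f y = 0)
    (hf_prob : ∫ y in Set.Ioi (0:ℝ), f y = 1)
    (β : ℕ → ℝ) (hβ : ∀ n : ℕ, β n = ∫ x in Set.Ioi (0:ℝ), x ^ n * f x)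
    (hβ_fin : ∀ n : ℕ, IntegrableOn (fun x => x ^ n * f x) (Set.Ioi 0))
    (hexp : IntegrableOn (fun x => Real.exp (lam * x) * f x) (Set.Ioi 0))
    (hinv : ∀ᵐ y ∂(volume.restrict (Set.Ici (0:ℝ))),
      f y = ∫ x in Set.Ioi (0:ℝ),
        f x * ((lam * x * Real.exp (-(lam * x) * (1 - G y)) + Real.exp (-(lam * x))) * g y)) :
    Summable (fun k : ℕ =>
      |(-1:ℝ) ^ (k+2) * lam ^ (k+2) * β (k+2) / ((k+2).factorial : ℝ) *
        (γ 1 1 - γ 1 (k+2))|) ∧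
    β 1 = γ 1 1 + ∑' k : ℕ,
      (-1:ℝ) ^ (k+2) * lam ^ (k+2) * β (k+2) / ((k+2).factorial : ℝ) *
        (γ 1 1 - γ 1 (k+2)) := by
  obtain rfl : G = fun y => ∫ t in (0:ℝ)..y, g t := funext hG
  have hg := integrable_of_setIntegral_Ioi_eq_one hg_supp hg_prob
  have hmom : IntegrableOn (fun y => y * g y) (Set.Ioi 0) := by simpa using hg_mom 1
  set S : ℝ → ℝ := fun y => 1 - ∫ t in (0:ℝ)..y, g t with hS
  set ν : Measure ℝ := volume.restrict (Set.Ioi 0) with hν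
  have hScont : Continuous S := continuous_one_sub_integral hg
  have hS0 (y) : 0 ≤ S y := one_sub_integral_nonneg hg hg_nonneg hg_prob y
  have hγ1 : γ 1 1 = ∫ y, y * g y ∂ν := by simp [hγ, hν]
  have hγk (k : ℕ) : γ 1 k = ∫ y, y * (k * S y ^ (k - 1)) * g y ∂ν := by
    rw [hγ]
    exact integral_congr_ae (.of_forall fun y => by simp only [hS]; ring)
  have hint (k : ℕ) : Integrable (fun y => y * (k * S y ^ (k - 1)) * g y) ν := by
    cases k with
    | zero => simp
    | succ k => simpa [IntegrableOn] using
        integrableOn_mul_minimum_density hg hg_nonneg hg_prob hmom k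
  have hγ1_nonneg : 0 ≤ γ 1 1 := by
    rw [hγ1]
    exact setIntegral_nonneg measurableSet_Ioi fun y hy => mul_nonneg (le_of_lt hy) (hg_nonneg y)
  have hγk_nonneg (k : ℕ) : 0 ≤ γ 1 k := by
    rw [hγk]
    exact setIntegral_nonneg measurableSet_Ioi fun y hy =>
      mul_nonneg (mul_nonneg (le_of_lt hy) (mul_nonneg k.cast_nonneg (pow_nonneg (hS0 y) _)))
        (hg_nonneg y)
  have hγk_le (k : ℕ) : γ 1 k ≤ 2 * γ 1 1 := by
    rw [hγk, hγ1]
    cases k with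
    | zero => simpa [hγ1] using hγ1_nonneg
    | succ k => simpa using integral_minimum_moment_le hg hg_nonneg hg_prob hmom k
  have hsum : Summable fun k : ℕ => lam ^ k / k.factorial * β k := by
    simp only [hβ]
    exact summable_pow_div_factorial_mul_integral_pow hlam.le hf_nonneg hβ_fin hexp
  have hβ_nonneg (k : ℕ) : 0 ≤ β k := by
    rw [hβ]
    exact setIntegral_nonneg measurableSet_Ioi fun x hx =>
      mul_nonneg (pow_nonneg (le_of_lt hx) k) (hf_nonneg x)
  set a : ℕ → ℝ := fun k => (-1) ^ k * lam ^ k * β k / k.factorial * (γ 1 1 - γ 1 k) with ha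
  set F : ℕ → ℝ × ℝ → ℝ := fun k p => ((-lam) ^ k / k.factorial * (p.1 ^ k * f p.1)) *
    (p.2 * g p.2 - p.2 * (k * S p.2 ^ (k - 1)) * g p.2) with hF
  have hφ (k : ℕ) : Integrable (fun x => (-lam) ^ k / k.factorial * (x ^ k * f x)) ν :=
    (hβ_fin k).const_mul _
  have hψ (k : ℕ) : Integrable (fun y => y * g y - y * (k * S y ^ (k - 1)) * g y) ν :=
    hmom.sub (hint k)
  have hF_int (k : ℕ) : Integrable (F k) (ν.prod ν) := (hφ k).mul_prod (hψ k)
  have hF_eq (k : ℕ) : ∫ p, F k p ∂ν.prod ν = a k := by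
    rw [hF, integral_prod_mul (fun x => (-lam) ^ k / k.factorial * (x ^ k * f x))
      (fun y => y * g y - y * (k * S y ^ (k - 1)) * g y), integral_const_mul,
      integral_sub hmom (hint k), ← hγ1, ← hγk, ← hβ, neg_pow]
    ring
  have hφ_norm (k : ℕ) : ∫ x, ‖(-lam) ^ k / k.factorial * (x ^ k * f x)‖ ∂ν =
      lam ^ k / k.factorial * β k := by
    rw [hβ, ← integral_const_mul]
    refine setIntegral_congr_fun measurableSet_Ioi fun x hx => ?_
    simp [abs_of_pos hlam, abs_of_pos (Set.mem_Ioi.1 hx), abs_of_nonneg (hf_nonneg x)]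
  have hψ_norm (k : ℕ) : ∫ y, ‖y * g y - y * (k * S y ^ (k - 1)) * g y‖ ∂ν ≤ 3 * γ 1 1 := by
    calc ∫ y, ‖y * g y - y * (k * S y ^ (k - 1)) * g y‖ ∂ν
        ≤ ∫ y, (y * g y + y * (k * S y ^ (k - 1)) * g y) ∂ν := by
          refine setIntegral_mono_on (hψ k).norm (hmom.add (hint k)) measurableSet_Ioi
            fun y hy => ?_
          have hy0 : 0 ≤ y := le_of_lt hy
          have h1 : 0 ≤ y * g y := mul_nonneg hy0 (hg_nonneg y)
          have h2 : 0 ≤ y * (k * S y ^ (k - 1)) * g y :=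
            mul_nonneg (mul_nonneg hy0 (mul_nonneg k.cast_nonneg (pow_nonneg (hS0 y) _)))
              (hg_nonneg y)
          exact (norm_sub_le _ _).trans_eq (by
            rw [Real.norm_of_nonneg h1, Real.norm_of_nonneg h2])
      _ = γ 1 1 + γ 1 k := by rw [integral_add hmom (hint k), hγ1, hγk]
      _ ≤ 3 * γ 1 1 := by linarith [hγk_le k]
  have hF_sum : Summable fun k => ∫ p, ‖F k p‖ ∂ν.prod ν := by
    refine (hsum.mul_right (3 * γ 1 1)).of_nonneg_of_le
      (fun k => integral_nonneg fun p => norm_nonneg _) fun k => ?_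
    simp only [hF, norm_mul _ (_ - _)]
    rw [integral_prod_mul (fun x => ‖(-lam) ^ k / k.factorial * (x ^ k * f x)‖)
      (fun y => ‖y * g y - y * (k * S y ^ (k - 1)) * g y‖), hφ_norm]
    exact mul_le_mul_of_nonneg_left (hψ_norm k) (mul_nonneg (by positivity) (hβ_nonneg k))
  have ha_abs : Summable fun k => |a k| :=
    hF_sum.of_nonneg_of_le (fun k => abs_nonneg _) fun k => by
      rw [← hF_eq]
      exact norm_integral_le_integral_norm (F k)
  set Φ : ℝ × ℝ → ℝ := fun p => f p.1 * (p.2 * g p.2) *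
    (lam * p.1 * Real.exp (-(lam * p.1) * S p.2) + Real.exp (-(lam * p.1))) with hΦ
  have hF_tsum (p : ℝ × ℝ) : ∑' k, F k p = Φ p := by
    have h := (hasSum_gated_kernel (lam * p.1) (S p.2)).mul_left (f p.1 * (p.2 * g p.2))
    refine Eq.trans (tsum_congr fun k => ?_) h.tsum_eq
    simp only [hF]
    rw [← neg_mul, mul_pow]
    ring
  have hΦ_int : Integrable Φ (ν.prod ν) := by
    have hx : Integrable (fun x => lam * (x ^ 1 * f x) + x ^ 0 * f x) ν :=
      ((hβ_fin 1).const_mul lam).add (hβ_fin 0)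
    refine (hx.mul_prod hmom).mono' (by fun_prop) ?_
    rw [hν, Measure.prod_restrict]
    filter_upwards [ae_restrict_mem (measurableSet_Ioi.prod measurableSet_Ioi)] with p hp
    have hp1 : 0 ≤ lam * p.1 := mul_nonneg hlam.le (le_of_lt hp.1)
    have hp2 : 0 ≤ p.2 * g p.2 := mul_nonneg (le_of_lt hp.2) (hg_nonneg _)
    have e1 : Real.exp (-(lam * p.1) * S p.2) ≤ 1 := by
      rw [Real.exp_le_one_iff, neg_mul]
      exact neg_nonpos.2 (mul_nonneg hp1 (hS0 _))
    have e2 : Real.exp (-(lam * p.1)) ≤ 1 := by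
      rw [Real.exp_le_one_iff]
      exact neg_nonpos.2 hp1
    have hfp := hf_nonneg p.1
    rw [Real.norm_of_nonneg (by positivity)]
    calc Φ p ≤ f p.1 * (p.2 * g p.2) * (lam * p.1 * 1 + 1) := by
          simp only [hΦ]
          gcongr
      _ = _ := by ring
  have hβ1 : ∫ p, Φ p ∂ν.prod ν = β 1 := by
    rw [integral_prod_symm _ hΦ_int, hβ]
    refine integral_congr_ae ?_
    filter_upwards [ae_restrict_of_ae_restrict_of_subset Set.Ioi_subset_Ici_self hinv] with y hy
    rw [hy, ← integral_const_mul]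
    refine integral_congr_ae (.of_forall fun x => ?_)
    simp only [hΦ, hS]
    ring
  have key : HasSum a (β 1) := by
    have h := hasSum_integral_of_summable_integral_norm hF_int hF_sum
    simpa only [hF_eq, hF_tsum, hβ1] using h
  refine ⟨(summable_nat_add_iff 2).2 ha_abs, ?_⟩
  have hβ0 : β 0 = 1 := by simp [hβ, hf_prob]
  have hγ0 : γ 1 0 = 0 := by simp [hγ]
  have h := key.summable.sum_add_tsum_nat_add 2
  rw [key.tsum_eq, Finset.sum_range_succ, Finset.sum_range_one] at h
  rw [← h]
  simp [ha, hβ0, hγ0]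
end

section
/- If ρ > 0 satisfies ρ² < 6/π² (equivalently ρ^{−2} > π²/6), then for every integer i ≥ 2, ρ^{−i} + (−1)^i i^{−i} > 1 + Σ_{j≥2, j≠i} (1/j)^i. (This is the strict diagonal dominance condition, row i ≥ 2, for the transformed moment system of the gated M/M/∞ queue.) -/
theorem tsum_one_div_pow_le_pi_sq_div_six {i : ℕ} (hi : 2 ≤ i) :
    ∑' j : ℕ, (1 / (j : ℝ)) ^ i ≤ Real.pi ^ 2 / 6 := by
  rw [← hasSum_zeta_two.tsum_eq]
  have hs : Summable fun j : ℕ => (1 / (j : ℝ)) ^ i := by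
    simpa only [one_div_pow] using Real.summable_one_div_nat_pow.2 (by omega : 1 < i)
  refine hs.tsum_le_tsum (fun j => ?_) hasSum_zeta_two.summable
  rw [← one_div_pow]
  refine pow_le_pow_of_le_one (by positivity) ?_ hi
  rw [one_div]
  exact Nat.cast_inv_le_one j

theorem one_add_tsum_one_div_pow_ne {i : ℕ} (hi : 2 ≤ i) :
    1 + ∑' j : {j : ℕ // 2 ≤ j ∧ j ≠ i}, (1 / (j.1 : ℝ)) ^ i
      = ∑' j : ℕ, (1 / (j : ℝ)) ^ i - (1 / (i : ℝ)) ^ i := by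
  have hs : Summable fun j : ℕ => (1 / (j : ℝ)) ^ i := by
    simpa only [one_div_pow] using Real.summable_one_div_nat_pow.2 (by omega : 1 < i)
  have hset : {j : ℕ | 2 ≤ j ∧ j ≠ i} = (↑({0, 1, i} : Finset ℕ) : Set ℕ)ᶜ := by
    ext j
    simp
    omega
  have hsplit := hs.sum_add_tsum_compl (s := {0, 1, i})
  rw [← tsum_congr_set_coe (fun j : ℕ => (1 / (j : ℝ)) ^ i) hset,
    Finset.sum_insert (by simp; omega), Finset.sum_insert (by simp; omega),
    Finset.sum_singleton] at hsplit
  have h0 : (1 / ((0 : ℕ) : ℝ)) ^ i = 0 := by simp; omega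
  have h1 : (1 / ((1 : ℕ) : ℝ)) ^ i = 1 := by simp
  rw [h0, h1] at hsplit
  change 0 + _ + ∑' j : {j : ℕ // 2 ≤ j ∧ j ≠ i}, (1 / (j.1 : ℝ)) ^ i = _ at hsplit
  linarith

/-- If `ρ > 0` satisfies `ρ² < 6/π²`, then for every integer `i ≥ 2`,
`ρ^{−i} + (−1)^i i^{−i} > 1 + Σ_{j≥2, j≠i} (1/j)^i`.  (Strict diagonal dominance,
row `i ≥ 2`, for the transformed moment system of the gated M/M/∞ queue.) -/
theorem stmt_9 (ρ : ℝ) (hρ : 0 < ρ) (hρ2 : ρ ^ 2 < 6 / Real.pi ^ 2) :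
    ∀ i : ℕ, 2 ≤ i →
      ρ ^ (-(i:ℤ)) + (-1:ℝ) ^ i * (i:ℝ) ^ (-(i:ℤ))
        > 1 + ∑' j : {j : ℕ // 2 ≤ j ∧ j ≠ i}, (1 / (j.1 : ℝ)) ^ i := by
  intro i hi
  have hinv (x : ℝ) : x ^ (-(i : ℤ)) = (1 / x) ^ i := by
    rw [zpow_neg, zpow_natCast, one_div, inv_pow]
  rw [one_add_tsum_one_div_pow_ne hi, hinv, hinv]
  have hsq : Real.pi ^ 2 / 6 < (1 / ρ) ^ 2 := by
    rw [one_div_pow, ← one_div_div]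
    exact one_div_lt_one_div_of_lt (by positivity) hρ2
  have hone : 1 ≤ 1 / ρ := by
    have hpos : 0 < 1 / ρ := by positivity
    nlinarith [Real.pi_gt_three]
  have hpow : (1 / ρ) ^ 2 ≤ (1 / ρ) ^ i := pow_le_pow_right₀ hone hi
  have hle := tsum_one_div_pow_le_pi_sq_div_six hi
  have hnonneg : 0 ≤ (1 / (i : ℝ)) ^ i := by positivity
  have hsign : -(1 / (i : ℝ)) ^ i ≤ (-1) ^ i * (1 / (i : ℝ)) ^ i := by
    rcases neg_one_pow_eq_or ℝ i with h | h <;> rw [h] <;> linarith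
  linarith
end

section
/- Suppose the infinite matrix A = (a_{ij})_{i,j≥1} of real numbers is strictly diagonally dominant (for each i, Σ_{j≠i} |a_{ij}| ≤ σ_i |a_{ii}| with 0 ≤ σ_i < 1), and satisfies Σ_{i=1}^∞ 1/|a_{ii}| < ∞ and Σ_{j≠i} |a_{ij}| ≤ M for some constant M and all i. Let (b_i)_{i≥1} be a bounded real sequence. Then: (1) for each N the truncated system Σ_{j=1}^N a_{ij} x_j^N = b_i (i = 1,…,N) has a unique solution (x_j^N)_{j≤N}; (2) for each fixed j the sequence (x_j^N)_{N≥j} is Cauchy, hence converges to a limit x_j; (3) the limit sequence (x_j) is bounded and satisfies Σ_{j=1}^∞ a_{ij} x_j = b_i for all i ≥ 1; (4) if moreover Σ_{i=1}^∞ |a_{ij}| < ∞ for each j, then (x_j) is the unique bounded solution of the infinite system. -/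
open Filter Topology

/-- A bounded sequence whose every uniform bound `B` improves to `s + q * B` with `q < 1`
is bounded by `s / (1 - q)`. -/
lemma abs_le_div_of_bound_improves {e : ℕ → ℝ} {s q : ℝ} (hq : q < 1)
    (hbdd : ∃ B, ∀ j, |e j| ≤ B)
    (h : ∀ B, (∀ j, |e j| ≤ B) → ∀ i, |e i| ≤ s + q * B) (i : ℕ) :
    |e i| ≤ s / (1 - q) := by
  obtain ⟨B, hB⟩ := hbdd
  have hba : BddAbove (Set.range fun j => |e j|) := ⟨B, by rintro _ ⟨j, rfl⟩; exact hB j⟩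
  have hle : ∀ j, |e j| ≤ ⨆ j, |e j| := fun j => le_ciSup hba j
  have hsup : (⨆ j, |e j|) ≤ s + q * ⨆ j, |e j| := ciSup_le (h _ hle)
  refine (hle i).trans ?_
  rw [le_div_iff₀ (by linarith)]
  linarith

/-- The off-diagonal part of a row controls the diagonal term of an equation. -/
lemma abs_diag_mul_le {r : ℕ → ℝ} {i : ℕ} (hr : Summable fun j : {j : ℕ // j ≠ i} => |r j.1|)
    {e : ℕ → ℝ} {B β : ℝ} (he : ∀ j, |e j| ≤ B) (hs : HasSum (fun j => r j * e j) β) :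
    |r i| * |e i| ≤ |β| + (∑' j : {j : ℕ // j ≠ i}, |r j.1|) * B := by
  have hoff : HasSum (fun j : {j : ℕ // j ≠ i} => r j.1 * e j.1) (β - r i * e i) := by
    have h1 := hasSum_ite_sub_hasSum hs i
    have h2 : Function.support (fun j => if j = i then 0 else r j * e j) ⊆ {j | j ≠ i} := by
      intro j hj hji
      exact hj (if_pos hji)
    have h3 := (hasSum_subtype_iff_of_support_subset h2).mpr h1
    exact h3.congr_fun fun j => (if_neg j.2).symm
  have hle : ‖∑' j : {j : ℕ // j ≠ i}, r j.1 * e j.1‖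
      ≤ (∑' j : {j : ℕ // j ≠ i}, |r j.1|) * B := by
    refine tsum_of_norm_bounded (hr.hasSum.mul_right B) fun j => ?_
    rw [Real.norm_eq_abs, abs_mul]
    exact mul_le_mul_of_nonneg_left (he _) (abs_nonneg _)
  rw [hoff.tsum_eq, Real.norm_eq_abs] at hle
  rw [← abs_mul]
  have := abs_sub_abs_le_abs_sub (r i * e i) β
  rw [abs_sub_comm] at this
  linarith

lemma summable_abs_of_summable_off_diag {r : ℕ → ℝ} {i : ℕ}
    (hr : Summable fun j : {j : ℕ // j ≠ i} => |r j.1|) : Summable fun j => |r j| :=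
  (Set.finite_singleton i).summable_compl_iff.mp hr

/-- Strict dominance of each row becomes uniform when the diagonal tends to infinity and the
off-diagonal sums `R` are bounded. -/
lemma exists_uniform_dominance {d R σ : ℕ → ℝ} {M : ℝ} (hd : ∀ i, 0 < d i)
    (hσ : ∀ i, σ i < 1) (hR : ∀ i, R i ≤ σ i * d i) (hM : ∀ i, R i ≤ M)
    (hlim : Tendsto (fun i => 1 / d i) atTop (𝓝 0)) :
    ∃ q, 0 ≤ q ∧ q < 1 ∧ ∀ i, R i ≤ q * d i := by
  have hMlim : Tendsto (fun i => M * (1 / d i)) atTop (𝓝 0) := by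
    simpa using hlim.const_mul M
  obtain ⟨I, hI⟩ := eventually_atTop.mp (hMlim.eventually_le_const (by norm_num : (0 : ℝ) < 1 / 2))
  have hfin : ∀ᶠ q in 𝓝[<] (1 : ℝ), ∀ i ∈ Finset.range I, σ i < q :=
    (Filter.eventually_all_finset _).mpr fun i _ =>
      nhdsWithin_le_nhds (eventually_gt_nhds (hσ i))
  have hhalf : ∀ᶠ q in 𝓝[<] (1 : ℝ), 1 / 2 < q :=
    nhdsWithin_le_nhds (eventually_gt_nhds (by norm_num))
  obtain ⟨q, ⟨hq1, hq2⟩, hq3⟩ := ((hfin.and hhalf).and self_mem_nhdsWithin).exists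
  refine ⟨q, by linarith, hq3, fun i => ?_⟩
  rcases lt_or_ge i I with h | h
  · exact (hR i).trans (mul_le_mul_of_nonneg_right (hq1 i (Finset.mem_range.mpr h)).le (hd i).le)
  · have h1 := hI i h
    rw [mul_one_div, div_le_iff₀ (hd i)] at h1
    have := mul_le_mul_of_nonneg_right hq2.le (hd i).le
    linarith [hM i]

/-- Finite sections of a strictly diagonally dominant infinite matrix are uniquely solvable. -/
lemma existsUnique_truncated_solution {a : ℕ → ℕ → ℝ} (b : ℕ → ℝ)
    (hrow : ∀ i, Summable fun j : {j : ℕ // j ≠ i} => |a i j.1|)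
    (hdom : ∀ i, ∑' j : {j : ℕ // j ≠ i}, |a i j.1| < |a i i|) (N : ℕ) :
    ∃! x : Fin N → ℝ, ∀ i : Fin N, ∑ j : Fin N, a i.1 j.1 * x j = b i.1 := by
  let A : Matrix (Fin N) (Fin N) ℝ := fun i j => a i.1 j.1
  have hdet : A.det ≠ 0 := by
    refine det_ne_zero_of_sum_row_lt_diag fun k => ?_
    refine lt_of_le_of_lt ?_ (hdom k)
    have hinj : Function.Injective
        (fun j : {j // j ∈ Finset.univ.erase k} =>
          (⟨j.1.1, fun h => (Finset.mem_erase.mp j.2).1 (Fin.ext h)⟩ : {j : ℕ // j ≠ k.1})) := by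
      intro j j' h
      exact Subtype.ext (Fin.ext (congrArg Subtype.val h))
    rw [← Finset.sum_attach, ← Finset.univ_eq_attach, ← tsum_fintype (L := .unconditional _)]
    exact Summable.tsum_le_tsum_of_inj _ hinj (fun _ _ => abs_nonneg _)
      (fun _ => le_rfl) (hasSum_fintype _).summable (hrow k)
  have hunit : IsUnit A := (Matrix.isUnit_iff_isUnit_det A).mpr hdet.isUnit
  have hbij : Function.Bijective A.mulVec :=
    ⟨Matrix.mulVec_injective_iff_isUnit.mpr hunit, Matrix.mulVec_surjective_iff_isUnit.mpr hunit⟩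
  have := hbij.existsUnique (fun i => b i.1)
  simpa only [funext_iff, Matrix.mulVec, dotProduct] using this


/-- Truncation theorem for infinite linear systems with a strictly diagonally dominant
matrix (indices relabelled to start at 0): (1) each truncated `N × N` system has a
unique solution; (2) for fixed `j` the truncated solutions form a Cauchy sequence,
hence converge to a limit `x j`; (3) the limit sequence is bounded and solves the
infinite system; (4) if moreover each column is absolutely summable, the bounded
solution is unique. -/
theorem stmt_10 (a : ℕ → ℕ → ℝ) (b : ℕ → ℝ)
    (ha_diag : ∀ i, a i i ≠ 0)
    (hrow_sum : ∀ i, Summable fun j : {j : ℕ // j ≠ i} => |a i j.1|)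
    (σ : ℕ → ℝ) (hσ : ∀ i, 0 ≤ σ i ∧ σ i < 1)
    (hdd : ∀ i, ∑' j : {j : ℕ // j ≠ i}, |a i j.1| ≤ σ i * |a i i|)
    (hdiag_sum : Summable fun i => 1 / |a i i|)
    (M : ℝ) (hM : ∀ i, ∑' j : {j : ℕ // j ≠ i}, |a i j.1| ≤ M)
    (Cb : ℝ) (hb : ∀ i, |b i| ≤ Cb) :
    (∀ N : ℕ, ∃! x : Fin N → ℝ, ∀ i : Fin N, ∑ j : Fin N, a i.1 j.1 * x j = b i.1) ∧
    ∀ xN : (N : ℕ) → Fin N → ℝ,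
      (∀ N : ℕ, ∀ i : Fin N, ∑ j : Fin N, a i.1 j.1 * xN N j = b i.1) →
      ∃ x : ℕ → ℝ,
        (∀ j : ℕ,
          CauchySeq (fun N : ℕ => if h : j < N then xN N ⟨j, h⟩ else 0) ∧
          Filter.Tendsto (fun N : ℕ => if h : j < N then xN N ⟨j, h⟩ else 0)
            Filter.atTop (nhds (x j))) ∧
        (∃ C : ℝ, ∀ j, |x j| ≤ C) ∧
        (∀ i, HasSum (fun j => a i j * x j) (b i)) ∧
        ((∀ j, Summable fun i => |a i j|) →
          ∀ x' : ℕ → ℝ, (∃ C : ℝ, ∀ j, |x' j| ≤ C) →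
            (∀ i, HasSum (fun j => a i j * x' j) (b i)) → x' = x) := by
  have hd : ∀ i, 0 < |a i i| := fun i => abs_pos.mpr (ha_diag i)
  have hdom : ∀ i, ∑' j : {j : ℕ // j ≠ i}, |a i j.1| < |a i i| := fun i =>
    (hdd i).trans_lt (by nlinarith [hd i, (hσ i).2])
  refine ⟨existsUnique_truncated_solution b hrow_sum hdom, fun xN hxN => ?_⟩
  have hlim : Tendsto (fun i => 1 / |a i i|) atTop (𝓝 0) := hdiag_sum.tendsto_atTop_zero
  obtain ⟨q, hq0, hq1, hq⟩ := exists_uniform_dominance hd (fun i => (hσ i).2) hdd hM hlim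
  obtain ⟨W, hW⟩ := hlim.bddAbove_range
  replace hW : ∀ i, 1 / |a i i| ≤ W := fun i => hW ⟨i, rfl⟩
  have hCb : 0 ≤ Cb := (abs_nonneg _).trans (hb 0)
  have key : ∀ {i : ℕ} {e : ℕ → ℝ} {B β : ℝ}, (∀ j, |e j| ≤ B) →
      HasSum (fun j => a i j * e j) β → |e i| ≤ |β| * (1 / |a i i|) + q * B := by
    intro i e B β he hs
    have h1 := abs_diag_mul_le (hrow_sum i) he hs
    have h2 := mul_le_mul_of_nonneg_right (hq i) ((abs_nonneg _).trans (he 0))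
    have h3 : |e i| ≤ (|β| + q * |a i i| * B) / |a i i| := by
      rw [le_div_iff₀ (hd i)]
      linarith
    refine h3.trans_eq ?_
    have := (hd i).ne'
    field_simp
  set X : ℕ → ℕ → ℝ := fun N j => if h : j < N then xN N ⟨j, h⟩ else 0 with hX
  have hX0 : ∀ {N j}, N ≤ j → X N j = 0 := fun h => dif_neg (not_lt.mpr h)
  have hXsum : ∀ {N i}, i < N → HasSum (fun j => a i j * X N j) (b i) := by
    intro N i hi
    rw [← hxN N ⟨i, hi⟩]
    have h1 : HasSum (fun j => a i j * X N j) (∑ j ∈ Finset.range N, a i j * X N j) :=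
      hasSum_sum_of_ne_finset_zero fun j hj => by
        rw [hX0 (by simpa using hj), mul_zero]
    rw [Finset.sum_range] at h1
    simpa [hX] using h1
  have hXbdd : ∀ N, ∃ B, ∀ j, |X N j| ≤ B := by
    intro N
    refine ⟨∑ j ∈ Finset.range N, |X N j|, fun j => ?_⟩
    rcases lt_or_ge j N with h | h
    · exact Finset.single_le_sum (f := fun j => |X N j|) (fun _ _ => abs_nonneg _)
        (Finset.mem_range.mpr h)
    · rw [hX0 h, abs_zero]
      exact Finset.sum_nonneg fun _ _ => abs_nonneg _
  have hW0 : 0 ≤ W := (one_div_pos.mpr (hd 0)).le.trans (hW 0)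
  obtain ⟨C, hC⟩ : ∃ C, ∀ N j, |X N j| ≤ C := by
    refine ⟨Cb * W / (1 - q), fun N => abs_le_div_of_bound_improves hq1 (hXbdd N) ?_⟩
    intro B hB i
    rcases lt_or_ge i N with h | h
    · refine (key hB (hXsum h)).trans ?_
      have := mul_le_mul (hb i) (hW i) (one_div_pos.mpr (hd i)).le hCb
      linarith
    · rw [hX0 h, abs_zero]
      have := (abs_nonneg _).trans (hB 0)
      positivity
  have hC0 : 0 ≤ C := (abs_nonneg _).trans (hC 0 0)
  have hdecay : ∀ N i, |X N i| ≤ (Cb + |M| * C) * (1 / |a i i|) := by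
    intro N i
    rcases lt_or_ge i N with h | h
    · rw [mul_one_div, le_div_iff₀ (hd i)]
      have h1 := abs_diag_mul_le (hrow_sum i) (hC N) (hXsum h)
      have h2 := mul_le_mul_of_nonneg_right ((hM i).trans (le_abs_self M)) hC0
      linarith [hb i]
    · rw [hX0 h, abs_zero]
      positivity
  have hcauchy : ∀ j, CauchySeq fun N => X N j := by
    intro j
    rw [Metric.cauchySeq_iff']
    intro ε hε
    have hs : 0 < ε / 2 * (1 - q) := mul_pos (half_pos hε) (by linarith)
    have hdlim : Tendsto (fun i => (Cb + |M| * C) * (1 / |a i i|)) atTop (𝓝 0) := by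
      simpa using hlim.const_mul (Cb + |M| * C)
    obtain ⟨N, hN⟩ := eventually_atTop.mp (hdlim.eventually_le_const hs)
    refine ⟨N, fun n hn => ?_⟩
    have hbound : |X n j - X N j| ≤ ε / 2 * (1 - q) / (1 - q) := by
      refine abs_le_div_of_bound_improves (e := fun j => X n j - X N j) hq1
        ⟨C + C, fun j => (abs_sub _ _).trans (add_le_add (hC n j) (hC N j))⟩ ?_ j
      intro B hB i
      rcases lt_or_ge i N with h | h
      · have hsub : HasSum (fun j => a i j * (X n j - X N j)) 0 := by
          simpa [mul_sub] using (hXsum (h.trans_le hn)).sub (hXsum h)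
        have := key hB hsub
        simp only [abs_zero, zero_mul, zero_add] at this
        linarith
      · have hB0 := (abs_nonneg _).trans (hB 0)
        rw [hX0 h, sub_zero]
        have := (hdecay n i).trans (hN i h)
        have := mul_nonneg hq0 hB0
        linarith
    rw [mul_div_cancel_right₀ _ (by linarith : (1 - q) ≠ 0)] at hbound
    rw [Real.dist_eq]
    linarith
  choose x hx using fun j => cauchySeq_tendsto_of_complete (hcauchy j)
  have hxC : ∀ j, |x j| ≤ C := fun j =>
    le_of_tendsto (hx j).abs (Eventually.of_forall fun N => hC N j)
  have habs : ∀ i, Summable fun j => |a i j| * C := fun i =>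
    (summable_abs_of_summable_off_diag (hrow_sum i)).mul_right C
  have hle : ∀ {i j : ℕ} {y : ℝ}, |y| ≤ C → ‖a i j * y‖ ≤ |a i j| * C := by
    intro i j y hy
    rw [Real.norm_eq_abs, abs_mul]
    exact mul_le_mul_of_nonneg_left hy (abs_nonneg _)
  have hxsum : ∀ i, HasSum (fun j => a i j * x j) (b i) := by
    intro i
    have hlimsum : Tendsto (fun N => ∑' j, a i j * X N j) atTop (𝓝 (∑' j, a i j * x j)) :=
      tendsto_tsum_of_dominated_convergence (habs i) (fun j => (hx j).const_mul _)
        (Eventually.of_forall fun N j => hle (hC N j))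
    have hconst : Tendsto (fun N => ∑' j, a i j * X N j) atTop (𝓝 (b i)) :=
      tendsto_const_nhds.congr' ((eventually_gt_atTop i).mono fun N hN => (hXsum hN).tsum_eq.symm)
    rw [← tendsto_nhds_unique hlimsum hconst]
    exact (Summable.of_norm_bounded (habs i) fun j => hle (hxC j)).hasSum
  refine ⟨x, fun j => ⟨hcauchy j, hx j⟩, ⟨C, hxC⟩, hxsum, ?_⟩
  rintro - x' ⟨C', hC'⟩ hx'
  funext i
  have hzero : |x' i - x i| ≤ 0 / (1 - q) := by
    refine abs_le_div_of_bound_improves (e := fun j => x' j - x j) hq1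
      ⟨C' + C, fun j => (abs_sub _ _).trans (add_le_add (hC' j) (hxC j))⟩ ?_ i
    intro B hB i
    have hsub : HasSum (fun j => a i j * (x' j - x j)) 0 := by
      simpa [mul_sub] using (hx' i).sub (hxsum i)
    simpa using key hB hsub
  rw [zero_div] at hzero
  exact sub_eq_zero.mp (abs_nonpos_iff.mp hzero)
end

section
/- Let B be a probability measure on (0,∞) with finite second moment ∫ x² dB(x) < ∞, let μ > 0, set b₀ := 1 and b_k := ∫ e^{−kμx} dB(x) for k ≥ 1, and define P_{ij} := Σ_{k=0}^i C(i,k) (−1)^k b_k^{j−1} (b_k − 1) for i, j ≥ 1. Then there exists a sequence (π_i)_{i≥1} of nonnegative reals with Σ_{i=1}^∞ π_i = 1, Σ_{i=1}^∞ i π_i < ∞, and π_j = Σ_{i=1}^∞ π_i P_{ij} for every j ≥ 1; i.e., the Markov chain of the number of customers served per stage in the synchronized gated GI/M/∞ queue has an invariant probability distribution with finite mean. -/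
open MeasureTheory

open Filter Topology Polynomial

namespace GatedQueue

section TailOperator

variable {T : ℕ → ℕ → ℝ} {β : ℝ}

/-- Bounds on `T i j = P(N > j)`, where `N` is the size of the stage that follows a stage
of size `i`. -/
structure IsStageTail (T : ℕ → ℕ → ℝ) (β : ℝ) : Prop where
  zero_left : ∀ j, T 0 j = 0
  mono : ∀ i j, T i j ≤ T (i + 1) j
  le_one : ∀ i j, T i j ≤ 1
  anti : ∀ i j, T i (j + 1) ≤ T i j
  diff_le : ∀ i j, T (i + 1) j - T i j ≤ β ^ j
  zero_right : ∀ i, T (i + 1) 0 = 1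
  nonneg_base : 0 ≤ β
  base_lt_one : β < 1

/-- The action of the chain on tail functions. -/
noncomputable def tailOp (T : ℕ → ℕ → ℝ) (G : ℕ → ℝ) (j : ℕ) : ℝ :=
  ∑' i, G i * (T (i + 1) j - T i j)

/-- A summable upper bound preserved by `tailOp`. -/
noncomputable def tailBound (β : ℝ) (j : ℕ) : ℝ :=
  min 1 (((1 - √β)⁻¹ * √β ^ j) ^ 2)

lemma sqrt_lt_one (hβ : β < 1) : √β < 1 := by
  rw [Real.sqrt_lt' one_pos]; simpa using hβ

lemma tailBound_nonneg (j : ℕ) : 0 ≤ tailBound β j := le_min zero_le_one (sq_nonneg _)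

lemma tailBound_le (hβ : β < 1) (j : ℕ) : tailBound β j ≤ (1 - √β)⁻¹ * √β ^ j := by
  have h1 := sqrt_lt_one hβ
  have hu : 0 ≤ (1 - √β)⁻¹ * √β ^ j :=
    mul_nonneg (inv_nonneg.2 (by linarith)) (pow_nonneg (Real.sqrt_nonneg _) _)
  unfold tailBound
  rcases le_total ((1 - √β)⁻¹ * √β ^ j) 1 with h | h
  · exact (min_le_right _ _).trans (by nlinarith)
  · exact (min_le_left _ _).trans h

lemma hasSum_geometric_bound (hβ : β < 1) :
    HasSum (fun j : ℕ => (1 - √β)⁻¹ * √β ^ j) ((1 - √β)⁻¹ * (1 - √β)⁻¹) :=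
  (hasSum_geometric_of_lt_one (Real.sqrt_nonneg _) (sqrt_lt_one hβ)).mul_left _

lemma summable_tailBound (hβ : β < 1) : Summable (tailBound β) :=
  .of_nonneg_of_le tailBound_nonneg (tailBound_le hβ) (hasSum_geometric_bound hβ).summable

lemma sum_tailBound_le (hβ : β < 1) (n : ℕ) :
    ∑ j ∈ Finset.range n, tailBound β j ≤ (1 - √β)⁻¹ ^ 2 := by
  rw [sq]
  refine (Finset.sum_le_sum fun j _ => tailBound_le hβ j).trans ?_
  refine sum_le_hasSum _ (fun j _ => ?_) (hasSum_geometric_bound hβ)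
  exact mul_nonneg (inv_nonneg.2 (by linarith [sqrt_lt_one hβ]))
    (pow_nonneg (Real.sqrt_nonneg _) _)

lemma tailBound_zero (hβ : β < 1) : tailBound β 0 = 1 := by
  have h1 := sqrt_lt_one hβ
  have h2 : 1 ≤ (1 - √β)⁻¹ :=
    (one_le_inv₀ (by linarith)).2 (by linarith [Real.sqrt_nonneg β])
  simp only [tailBound, pow_zero, mul_one]
  exact min_eq_left (by nlinarith)

namespace IsStageTail

lemma diff_nonneg (hT : IsStageTail T β) (i j : ℕ) : 0 ≤ T (i + 1) j - T i j :=
  sub_nonneg.2 (hT.mono i j)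

lemma diff_le_one (hT : IsStageTail T β) (i j : ℕ) : T (i + 1) j - T i j ≤ 1 :=
  (hT.diff_le i j).trans (pow_le_one₀ hT.nonneg_base hT.base_lt_one.le)

lemma nonneg (hT : IsStageTail T β) (i j : ℕ) : 0 ≤ T i j := by
  rw [← hT.zero_left j]
  exact monotone_nat_of_le_succ (fun i => hT.mono i j) (Nat.zero_le i)

lemma summable_mul_diff (hT : IsStageTail T β) {G : ℕ → ℝ} (h0 : ∀ i, 0 ≤ G i)
    (hG : Summable G) (j : ℕ) : Summable fun i => G i * (T (i + 1) j - T i j) :=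
  .of_nonneg_of_le (fun i => mul_nonneg (h0 i) (hT.diff_nonneg i j))
    (fun i => mul_le_of_le_one_right (h0 i) (hT.diff_le_one i j)) hG

lemma tailOp_nonneg (hT : IsStageTail T β) {G : ℕ → ℝ} (h0 : ∀ i, 0 ≤ G i) (j : ℕ) :
    0 ≤ tailOp T G j :=
  tsum_nonneg fun i => mul_nonneg (h0 i) (hT.diff_nonneg i j)

lemma tailOp_mono (hT : IsStageTail T β) {G G' : ℕ → ℝ} (h0 : ∀ i, 0 ≤ G i)
    (hle : ∀ i, G i ≤ G' i) (hG' : Summable G') (j : ℕ) : tailOp T G j ≤ tailOp T G' j :=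
  Summable.tsum_le_tsum (fun i => mul_le_mul_of_nonneg_right (hle i) (hT.diff_nonneg i j))
    (hT.summable_mul_diff h0 (.of_nonneg_of_le h0 hle hG') j)
    (hT.summable_mul_diff (fun i => (h0 i).trans (hle i)) hG' j)

lemma tailOp_le_tailBound (hT : IsStageTail T β) {G : ℕ → ℝ} (h0 : ∀ i, 0 ≤ G i)
    (hle : ∀ i, G i ≤ tailBound β i) (j : ℕ) : tailOp T G j ≤ tailBound β j := by
  refine Real.tsum_le_of_sum_range_le
    (fun i => mul_nonneg (h0 i) (hT.diff_nonneg i j)) fun n => le_min ?_ ?_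
  · calc ∑ i ∈ Finset.range n, G i * (T (i + 1) j - T i j)
        ≤ ∑ i ∈ Finset.range n, (T (i + 1) j - T i j) :=
          Finset.sum_le_sum fun i _ => mul_le_of_le_one_left (hT.diff_nonneg i j)
            ((hle i).trans (min_le_left _ _))
      _ = T n j := by rw [Finset.sum_range_sub (fun i => T i j), hT.zero_left, sub_zero]
      _ ≤ 1 := hT.le_one n j
  · calc ∑ i ∈ Finset.range n, G i * (T (i + 1) j - T i j)
        ≤ ∑ i ∈ Finset.range n, tailBound β i * β ^ j :=
          Finset.sum_le_sum fun i _ => mul_le_mul (hle i) (hT.diff_le i j)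
            (hT.diff_nonneg i j) (tailBound_nonneg i)
      _ = (∑ i ∈ Finset.range n, tailBound β i) * β ^ j := by rw [Finset.sum_mul]
      _ ≤ (1 - √β)⁻¹ ^ 2 * β ^ j :=
          mul_le_mul_of_nonneg_right (sum_tailBound_le hT.base_lt_one n)
            (pow_nonneg hT.nonneg_base _)
      _ = ((1 - √β)⁻¹ * √β ^ j) ^ 2 := by
          rw [mul_pow, ← pow_mul, mul_comm j 2, pow_mul, Real.sq_sqrt hT.nonneg_base]

lemma tailOp_zero (hT : IsStageTail T β) (G : ℕ → ℝ) : tailOp T G 0 = G 0 := by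
  rw [tailOp, tsum_eq_single 0]
  · simp [hT.zero_right, hT.zero_left]
  · intro i hi
    obtain ⟨k, rfl⟩ := Nat.exists_eq_succ_of_ne_zero hi
    simp [hT.zero_right]

/-- Summation by parts for `tailOp`. -/
lemma hasSum_sub_mul (hT : IsStageTail T β) {G : ℕ → ℝ} (h0 : ∀ i, 0 ≤ G i)
    (hG : Summable G) (hanti : Antitone G) (j : ℕ) :
    HasSum (fun i => (G i - G (i + 1)) * T (i + 1) j) (tailOp T G j) := by
  rw [hasSum_iff_tendsto_nat_of_nonneg fun i =>
    mul_nonneg (sub_nonneg.2 (hanti (Nat.le_succ i))) (hT.nonneg _ _)]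
  have hparts : ∀ n, ∑ i ∈ Finset.range n, (G i - G (i + 1)) * T (i + 1) j =
      ∑ i ∈ Finset.range n, G i * (T (i + 1) j - T i j) - G n * T n j := by
    intro n
    induction n with
    | zero => simp [hT.zero_left]
    | succ n ih => rw [Finset.sum_range_succ, Finset.sum_range_succ, ih]; ring
  have hlim : Tendsto (fun n => G n * T n j) atTop (𝓝 0) :=
    squeeze_zero (fun n => mul_nonneg (h0 n) (hT.nonneg n j))
      (fun n => mul_le_of_le_one_right (h0 n) (hT.le_one n j)) hG.tendsto_atTop_zero
  simpa [hparts, tailOp] using (hT.summable_mul_diff h0 hG j).hasSum.tendsto_sum_nat.sub hlim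

lemma tailOp_antitone (hT : IsStageTail T β) {G : ℕ → ℝ} (h0 : ∀ i, 0 ≤ G i)
    (hG : Summable G) (hanti : Antitone G) : Antitone (tailOp T G) :=
  antitone_nat_of_succ_le fun j =>
    hasSum_le (fun i => mul_le_mul_of_nonneg_left (hT.anti _ _)
      (sub_nonneg.2 (hanti (Nat.le_succ i))))
      (hT.hasSum_sub_mul h0 hG hanti (j + 1)) (hT.hasSum_sub_mul h0 hG hanti j)

/-- Monotone iteration from the tail function of the point mass at `1`. -/
lemma exists_fixed_tail (hT : IsStageTail T β) :
    ∃ G : ℕ → ℝ, (∀ i, 0 ≤ G i) ∧ Summable G ∧ Antitone G ∧ G 0 = 1 ∧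
      ∀ j, tailOp T G j = G j := by
  set F : ℕ → ℕ → ℝ := fun n => (tailOp T)^[n] (fun j => if j = 0 then 1 else 0) with hF
  have hS : ∀ n, F (n + 1) = tailOp T (F n) := fun n => Function.iterate_succ_apply' _ _ _
  have hbd := summable_tailBound hT.base_lt_one
  have inv : ∀ n, (∀ i, 0 ≤ F n i) ∧ (∀ i, F n i ≤ tailBound β i) ∧ Antitone (F n) ∧
      F n 0 = 1 := by
    intro n
    induction n with
    | zero =>
      refine ⟨fun i => ?_, fun i => ?_, antitone_nat_of_succ_le fun i => ?_, by simp [hF]⟩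
      · simp only [hF, Function.iterate_zero, id]; split_ifs <;> norm_num
      · simp only [hF, Function.iterate_zero, id]
        split_ifs with h
        · rw [h, tailBound_zero hT.base_lt_one]
        · exact tailBound_nonneg i
      · simp only [hF, Function.iterate_zero, id, Nat.succ_ne_zero, if_false]
        split_ifs <;> norm_num
    | succ n ih =>
      obtain ⟨h0, hle, hanti, h1⟩ := ih
      rw [hS]
      exact ⟨hT.tailOp_nonneg h0, hT.tailOp_le_tailBound h0 hle,
        hT.tailOp_antitone h0 (.of_nonneg_of_le h0 hle hbd) hanti,
        (hT.tailOp_zero _).trans h1⟩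
  have hsum : ∀ n, Summable (F n) := fun n => .of_nonneg_of_le (inv n).1 (inv n).2.1 hbd
  have hmono : ∀ n i, F n i ≤ F (n + 1) i := by
    intro n
    induction n with
    | zero =>
      intro i
      rcases Nat.eq_zero_or_pos i with rfl | hi
      · rw [(inv 0).2.2.2, (inv 1).2.2.2]
      · refine le_trans (le_of_eq ?_) ((inv 1).1 i)
        simp [hF, hi.ne']
    | succ n ih =>
      intro i
      rw [hS (n + 1)]
      conv_lhs => rw [hS n]
      exact hT.tailOp_mono (inv n).1 ih (hsum _) i
  set G : ℕ → ℝ := fun i => ⨆ n, F n i with hG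
  have hlim : ∀ i, Tendsto (fun n => F n i) atTop (𝓝 (G i)) := fun i =>
    tendsto_atTop_ciSup (monotone_nat_of_le_succ fun n => hmono n i)
      ⟨tailBound β i, by rintro _ ⟨n, rfl⟩; exact (inv n).2.1 i⟩
  have hG0 : ∀ i, 0 ≤ G i := fun i => ge_of_tendsto' (hlim i) fun n => (inv n).1 i
  have hGle : ∀ i, G i ≤ tailBound β i := fun i => le_of_tendsto' (hlim i) fun n => (inv n).2.1 i
  refine ⟨G, hG0, .of_nonneg_of_le hG0 hGle hbd,
    fun i k hik => le_of_tendsto_of_tendsto' (hlim k) (hlim i) fun n => (inv n).2.2.1 hik,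
    tendsto_nhds_unique (hlim 0) ?_, fun j => ?_⟩
  · simp [(inv _).2.2.2]
  · refine tendsto_nhds_unique ?_ ((tendsto_add_atTop_iff_nat 1).2 (hlim j))
    simp only [hS]
    refine tendsto_tsum_of_dominated_convergence hbd (fun i => (hlim i).mul_const _)
      (Eventually.of_forall fun n i => ?_)
    rw [Real.norm_of_nonneg (mul_nonneg ((inv n).1 i) (hT.diff_nonneg i j))]
    exact (mul_le_of_le_one_right ((inv n).1 i) (hT.diff_le_one i j)).trans ((inv n).2.1 i)

lemma exists_invariant (hT : IsStageTail T β) :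
    ∃ π : ℕ → ℝ, (∀ i, 0 ≤ π i) ∧
      HasSum (fun i : ℕ => π (i + 1)) 1 ∧
      Summable (fun i : ℕ => ((i : ℝ) + 1) * π (i + 1)) ∧
      ∀ j : ℕ, 1 ≤ j →
        HasSum (fun i : ℕ => π (i + 1) * (T (i + 1) (j - 1) - T (i + 1) j)) (π j) := by
  obtain ⟨G, h0, hG, hanti, h1, hfix⟩ := hT.exists_fixed_tail
  have hd : ∀ i, 0 ≤ G i - G (i + 1) := fun i => sub_nonneg.2 (hanti (Nat.le_succ i))
  refine ⟨fun i => G (i - 1) - G i, fun i => sub_nonneg.2 (hanti (Nat.sub_le i 1)), ?_, ?_, ?_⟩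
  · simp only [Nat.add_sub_cancel]
    rw [hasSum_iff_tendsto_nat_of_nonneg hd]
    simp only [Finset.sum_range_sub', h1]
    simpa using hG.tendsto_atTop_zero.const_sub 1
  · simp only [Nat.add_sub_cancel]
    refine summable_of_sum_range_le (c := ∑' i, G i)
      (fun i => mul_nonneg (by positivity) (hd i)) fun n => ?_
    have hparts : ∑ i ∈ Finset.range n, ((i : ℝ) + 1) * (G i - G (i + 1)) =
        ∑ i ∈ Finset.range n, G i - n * G n := by
      induction n with
      | zero => simp
      | succ n ih => rw [Finset.sum_range_succ, Finset.sum_range_succ, ih]; push_cast; ring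
    rw [hparts]
    have := hG.sum_le_tsum (Finset.range n) fun i _ => h0 i
    have : 0 ≤ n * G n := mul_nonneg n.cast_nonneg (h0 n)
    linarith
  · intro j _
    have h := (hT.hasSum_sub_mul h0 hG hanti (j - 1)).sub (hT.hasSum_sub_mul h0 hG hanti j)
    simp only [hfix, ← mul_sub] at h
    simpa only [Nat.add_sub_cancel] using h

end IsStageTail

end TailOperator

section Moments

variable {B : Measure ℝ} {μ : ℝ} {b : ℕ → ℝ}

/-- The linear operator on polynomials with `X ^ k ↦ b k • X ^ k`. -/
noncomputable def coeffMul (b : ℕ → ℝ) : Module.End ℝ ℝ[X] :=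
  Polynomial.lsum fun k => b k • Polynomial.monomial k

lemma coeffMul_monomial (b : ℕ → ℝ) (k : ℕ) (c : ℝ) :
    coeffMul b (monomial k c) = b k • monomial k c := by
  simp [coeffMul, Polynomial.lsum_apply]

lemma coeffMul_pow_X_pow (b : ℕ → ℝ) (j k : ℕ) :
    (coeffMul b ^ j) (X ^ k) = b k ^ j • (X ^ k : ℝ[X]) := by
  induction j with
  | zero => simp
  | succ j ih =>
    rw [pow_succ', Module.End.mul_apply, ih, map_smul, ← monomial_one_right_eq_X_pow,
      coeffMul_monomial, smul_smul, pow_succ]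

/-- The linear functional on polynomials with `X ^ k ↦ b k ^ j`. -/
noncomputable def momentFun (b : ℕ → ℝ) (j : ℕ) : ℝ[X] →ₗ[ℝ] ℝ :=
  (Polynomial.leval 1).comp (coeffMul b ^ j)

lemma momentFun_apply (b : ℕ → ℝ) (j : ℕ) (p : ℝ[X]) :
    momentFun b j p = ((coeffMul b ^ j) p).eval 1 := rfl

lemma momentFun_X_pow (b : ℕ → ℝ) (j k : ℕ) : momentFun b j (X ^ k) = b k ^ j := by
  simp [momentFun_apply, coeffMul_pow_X_pow]

lemma momentFun_one (hb0 : b 0 = 1) (j : ℕ) : momentFun b j 1 = 1 := by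
  simpa [hb0] using momentFun_X_pow b j 0

lemma momentFun_one_sub_X_pow (b : ℕ → ℝ) (i j : ℕ) :
    momentFun b j ((1 - X) ^ i) =
      ∑ k ∈ Finset.range (i + 1), (i.choose k : ℝ) * (-1) ^ k * b k ^ j := by
  have h : ((1 - X) ^ i : ℝ[X]) =
      ∑ k ∈ Finset.range (i + 1), ((i.choose k : ℝ) * (-1) ^ k) • (X ^ k : ℝ[X]) := by
    rw [sub_eq_neg_add, add_pow]
    refine Finset.sum_congr rfl fun k _ => ?_
    rw [smul_eq_C_mul, neg_pow]
    simp
    ring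
  rw [h, map_sum]
  simp [momentFun_X_pow]

lemma integral_exp_eq [IsProbabilityMeasure B] (hb0 : b 0 = 1)
    (hb : ∀ k : ℕ, 1 ≤ k → b k = ∫ x, Real.exp (-((k : ℝ) * μ * x)) ∂B) (k : ℕ) :
    b k = ∫ x, Real.exp (-(μ * x)) ^ k ∂B := by
  rcases Nat.eq_zero_or_pos k with rfl | hk
  · simp [hb0]
  · rw [hb k hk]
    congr with x
    rw [← Real.exp_nat_mul]
    ring_nf

lemma ae_pos (hBpos : B (Set.Iic 0) = 0) : ∀ᵐ x ∂B, 0 < x := by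
  rw [ae_iff]
  simpa [Set.Iic] using hBpos

lemma exp_mem_Icc (hμ : 0 < μ) {x : ℝ} (hx : 0 < x) :
    Real.exp (-(μ * x)) ∈ Set.Icc (0 : ℝ) 1 :=
  ⟨(Real.exp_pos _).le, Real.exp_le_one_iff.2 (by have := mul_pos hμ hx; linarith)⟩

lemma integrable_exp_pow [IsProbabilityMeasure B] (hBpos : B (Set.Iic 0) = 0) (hμ : 0 < μ)
    (k : ℕ) : Integrable (fun x => Real.exp (-(μ * x)) ^ k) B := by
  refine Integrable.of_bound (C := 1) (by fun_prop) ?_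
  filter_upwards [ae_pos hBpos] with x hx
  obtain ⟨h0, h1⟩ := exp_mem_Icc hμ hx
  rw [Real.norm_of_nonneg (pow_nonneg h0 k)]
  exact pow_le_one₀ h0 h1

lemma eval_coeffMul [IsProbabilityMeasure B] (hBpos : B (Set.Iic 0) = 0) (hμ : 0 < μ)
    (hb : ∀ k, b k = ∫ x, Real.exp (-(μ * x)) ^ k ∂B) (p : ℝ[X]) (z : ℝ) :
    Integrable (fun x => p.eval (z * Real.exp (-(μ * x)))) B ∧
      (coeffMul b p).eval z = ∫ x, p.eval (z * Real.exp (-(μ * x))) ∂B := by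
  induction p using Polynomial.induction_on' with
  | add p q hp hq =>
    simp only [eval_add, map_add]
    exact ⟨hp.1.add hq.1, by rw [hp.2, hq.2, integral_add hp.1 hq.1]⟩
  | monomial k c =>
    simp only [eval_monomial, mul_pow, coeffMul_monomial, eval_smul, smul_eq_mul]
    refine ⟨((integrable_exp_pow hBpos hμ k).const_mul _).const_mul _, ?_⟩
    rw [integral_const_mul, integral_const_mul, ← hb]
    ring

/-- Nonnegativity of a polynomial on the unit interval. -/
def NonnegOnUnit (p : ℝ[X]) : Prop := ∀ z ∈ Set.Icc (0 : ℝ) 1, 0 ≤ p.eval z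

lemma mul_exp_mem_Icc (hμ : 0 < μ) {x z : ℝ} (hx : 0 < x) (hz : z ∈ Set.Icc (0 : ℝ) 1) :
    z * Real.exp (-(μ * x)) ∈ Set.Icc (0 : ℝ) 1 :=
  unitInterval.mul_mem hz (exp_mem_Icc hμ hx)

lemma NonnegOnUnit.coeffMul [IsProbabilityMeasure B] (hBpos : B (Set.Iic 0) = 0) (hμ : 0 < μ)
    (hb : ∀ k, b k = ∫ x, Real.exp (-(μ * x)) ^ k ∂B) {p : ℝ[X]} (hp : NonnegOnUnit p) :
    NonnegOnUnit (coeffMul b p) := by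
  intro z hz
  rw [(eval_coeffMul hBpos hμ hb p z).2]
  refine integral_nonneg_of_ae ?_
  filter_upwards [ae_pos hBpos] with x hx
  exact hp _ (mul_exp_mem_Icc hμ hx hz)

lemma NonnegOnUnit.momentFun [IsProbabilityMeasure B] (hBpos : B (Set.Iic 0) = 0) (hμ : 0 < μ)
    (hb : ∀ k, b k = ∫ x, Real.exp (-(μ * x)) ^ k ∂B) {p : ℝ[X]} (hp : NonnegOnUnit p)
    (j : ℕ) : 0 ≤ momentFun b j p := by
  have h : NonnegOnUnit ((GatedQueue.coeffMul b ^ j) p) := by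
    induction j with
    | zero => simpa using hp
    | succ j ih =>
      rw [pow_succ', Module.End.mul_apply]
      exact ih.coeffMul hBpos hμ hb
  exact h 1 ⟨zero_le_one, le_rfl⟩

lemma momentFun_le_succ [IsProbabilityMeasure B] (hBpos : B (Set.Iic 0) = 0) (hμ : 0 < μ)
    (hb : ∀ k, b k = ∫ x, Real.exp (-(μ * x)) ^ k ∂B) {p : ℝ[X]}
    (hp : AntitoneOn (fun z => p.eval z) (Set.Icc 0 1)) (j : ℕ) :
    momentFun b j p ≤ momentFun b (j + 1) p := by
  have h : NonnegOnUnit (coeffMul b p - p) := by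
    intro z hz
    obtain ⟨hi, he⟩ := eval_coeffMul hBpos hμ hb p z
    have hle : ∫ _, p.eval z ∂B ≤ ∫ x, p.eval (z * Real.exp (-(μ * x))) ∂B := by
      refine integral_mono_ae (integrable_const _) hi ?_
      filter_upwards [ae_pos hBpos] with x hx
      exact hp (mul_exp_mem_Icc hμ hx hz) hz
        (mul_le_of_le_one_right hz.1 (exp_mem_Icc hμ hx).2)
    rw [eval_sub, he, sub_nonneg]
    simpa using hle
  have := h.momentFun hBpos hμ hb j
  rw [map_sub, sub_nonneg] at this
  rwa [momentFun_apply b (j + 1), pow_succ, Module.End.mul_apply]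

lemma moment_one_lt_one [IsProbabilityMeasure B] (hBpos : B (Set.Iic 0) = 0) (hμ : 0 < μ)
    (hb : ∀ k, b k = ∫ x, Real.exp (-(μ * x)) ^ k ∂B) : b 1 < 1 := by
  have hi := integrable_exp_pow hBpos hμ 1
  have hlt : ∀ᵐ x ∂B, 0 < 1 - Real.exp (-(μ * x)) ^ 1 := by
    filter_upwards [ae_pos hBpos] with x hx
    have := mul_pos hμ hx
    simpa using this
  have hpos : 0 < ∫ x, (1 - Real.exp (-(μ * x)) ^ 1) ∂B := by
    rw [integral_pos_iff_support_of_nonneg_ae (hlt.mono fun x hx => hx.le)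
      ((integrable_const 1).sub hi)]
    have : Function.support (fun x => 1 - Real.exp (-(μ * x)) ^ 1) =ᵐ[B] Set.univ :=
      eventuallyEq_univ.2 (hlt.mono fun x hx => hx.ne')
    rw [measure_congr this]
    simp
  rw [integral_sub (integrable_const 1) hi, ← hb] at hpos
  simpa using hpos

lemma isStageTail_moment [IsProbabilityMeasure B] (hBpos : B (Set.Iic 0) = 0) (hμ : 0 < μ)
    (hb0 : b 0 = 1) (hb : ∀ k, b k = ∫ x, Real.exp (-(μ * x)) ^ k ∂B) :
    IsStageTail (fun i j => 1 - momentFun b j ((1 - X) ^ i)) (b 1) := by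
  have hdiff : ∀ i j, (1 - momentFun b j ((1 - X) ^ (i + 1))) -
      (1 - momentFun b j ((1 - X) ^ i)) = momentFun b j (X * (1 - X) ^ i) := by
    intro i j
    rw [sub_sub_sub_cancel_left, ← map_sub]
    congr 1
    ring
  refine ⟨fun j => ?_, fun i j => ?_, fun i j => ?_, fun i j => ?_, fun i j => ?_, fun i => ?_,
    ?_, moment_one_lt_one hBpos hμ hb⟩
  · simp [momentFun_one hb0]
  · rw [← sub_nonneg, hdiff]
    refine NonnegOnUnit.momentFun hBpos hμ hb (fun z hz => ?_) j
    simpa using mul_nonneg hz.1 (pow_nonneg (sub_nonneg.2 hz.2) i)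
  · rw [sub_le_self_iff]
    refine NonnegOnUnit.momentFun hBpos hμ hb (fun z hz => ?_) j
    simpa using pow_nonneg (sub_nonneg.2 hz.2) i
  · refine sub_le_sub_left (momentFun_le_succ hBpos hμ hb (fun z hz w hw hzw => ?_) j) 1
    simpa using pow_le_pow_left₀ (sub_nonneg.2 hw.2) (sub_le_sub_left hzw 1) i
  · rw [hdiff, ← momentFun_X_pow, ← sub_nonneg, ← map_sub]
    refine NonnegOnUnit.momentFun hBpos hμ hb (fun z hz => ?_) j
    have h : z * (1 - z) ^ i ≤ z := mul_le_of_le_one_right hz.1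
      (pow_le_one₀ (sub_nonneg.2 hz.2) (sub_le_self 1 hz.1))
    simpa using h
  · simp [momentFun_apply]
  · rw [hb 1]
    exact integral_nonneg fun x => pow_nonneg (Real.exp_pos _).le 1

end Moments

end GatedQueue

/-- The Markov chain of the number of customers served per stage in the synchronized
gated GI/M/∞ queue (interarrival law `B` on `(0,∞)` with finite second moment,
exponential services with rate `μ`) has an invariant probability distribution with
finite mean. -/
theorem stmt_13 (B : Measure ℝ) [IsProbabilityMeasure B] (hBpos : B (Set.Iic 0) = 0)
    (hB2 : Integrable (fun x => x ^ 2) B)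
    (μ : ℝ) (hμ : 0 < μ)
    (b : ℕ → ℝ) (hb0 : b 0 = 1)
    (hb : ∀ k : ℕ, 1 ≤ k → b k = ∫ x, Real.exp (-((k:ℝ) * μ * x)) ∂B)
    (P : ℕ → ℕ → ℝ)
    (hP : ∀ i j : ℕ, 1 ≤ i → 1 ≤ j →
      P i j = ∑ k ∈ Finset.range (i+1), (i.choose k : ℝ) * (-1) ^ k * b k ^ (j-1) * (b k - 1)) :
    ∃ π : ℕ → ℝ, (∀ i, 0 ≤ π i) ∧
      HasSum (fun i : ℕ => π (i+1)) 1 ∧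
      Summable (fun i : ℕ => ((i:ℝ)+1) * π (i+1)) ∧
      ∀ j : ℕ, 1 ≤ j → HasSum (fun i : ℕ => π (i+1) * P (i+1) j) (π j) := by
  obtain ⟨π, h0, h1, hmean, hinv⟩ := (GatedQueue.isStageTail_moment hBpos hμ hb0
    (GatedQueue.integral_exp_eq hb0 hb)).exists_invariant
  refine ⟨π, h0, h1, hmean, fun j hj => ?_⟩
  convert hinv j hj using 3 with i
  rw [hP (i + 1) j (Nat.succ_pos i) hj, sub_sub_sub_cancel_left,
    GatedQueue.momentFun_one_sub_X_pow, GatedQueue.momentFun_one_sub_X_pow,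
    ← Finset.sum_sub_distrib]
  refine Finset.sum_congr rfl fun k _ => ?_
  obtain ⟨m, rfl⟩ := Nat.exists_eq_add_of_le' hj
  rw [Nat.add_sub_cancel]
  ring
end

section
/- For every m ≥ 1, x_m = Σ_{k=1}^∞ (−1)^{k−1} x_k b_k^{m−1}/(1−b_k)^m, the series converging absolutely. (This is the infinite linear system satisfied by the normalized factorial moments of the stationary number of customers served per stage in the gated GI/M/∞ queue.) -/
/-- Fubini for double series: the sum of the row sums is also the sum of the column sums. -/
theorem hasSum_swap_of_summable {f : ℕ × ℕ → ℝ} (hf : Summable f) {r c : ℕ → ℝ} {s : ℝ}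
    (hr : ∀ i, HasSum (fun k => f (i, k)) (r i)) (hc : ∀ k, HasSum (fun i => f (i, k)) (c k))
    (hs : HasSum r s) : HasSum c s := by
  have h1 : s = ∑' p, f p := hs.unique (hf.hasSum.prod_fiberwise hr)
  have h2 := ((Equiv.prodComm ℕ ℕ).hasSum_iff).mpr hf.hasSum
  rw [h1]
  exact h2.prod_fiberwise hc

theorem summable_choose_mul {w : ℕ → ℝ} (hw : ∀ i, 0 ≤ w i)
    (h2 : Summable fun i : ℕ => w (i + 1) * 2 ^ (i + 1)) :
    Summable fun p : ℕ × ℕ => ((p.1 + 1).choose (p.2 + 1) : ℝ) * w (p.1 + 1) := by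
  have hrow (i : ℕ) : HasSum (fun k => ((i + 1).choose (k + 1) : ℝ) * w (i + 1))
      (∑ k ∈ Finset.range (i + 1), ((i + 1).choose (k + 1) : ℝ) * w (i + 1)) := by
    refine hasSum_sum_of_ne_finset_zero fun k hk => ?_
    rw [Nat.choose_eq_zero_of_lt (by simpa using hk)]
    simp
  refine (summable_prod_of_nonneg fun p => mul_nonneg (Nat.cast_nonneg _) (hw _)).mpr
    ⟨fun i => (hrow i).summable, h2.of_nonneg_of_le (fun i => tsum_nonneg fun k =>
      mul_nonneg (Nat.cast_nonneg _) (hw _)) fun i => ?_⟩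
  rw [(hrow i).tsum_eq, ← Finset.sum_mul, mul_comm]
  refine mul_le_mul_of_nonneg_left ?_ (hw _)
  have h := Nat.sum_range_choose (i + 1)
  rw [Finset.sum_range_succ'] at h
  exact_mod_cast (show ∑ k ∈ Finset.range (i + 1), (i + 1).choose (k + 1) ≤ 2 ^ (i + 1) by omega)

/-- The series of `C(i, k) w_i` over `i ≥ 1` may be started at `i = k`. -/
theorem hasSum_choose_mul_succ {w : ℕ → ℝ} {k : ℕ} {s : ℝ}
    (h : HasSum (fun i => ((i + (k + 1)).choose (k + 1) : ℝ) * w (i + (k + 1))) s) :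
    HasSum (fun i => ((i + 1).choose (k + 1) : ℝ) * w (i + 1)) s := by
  rw [← (add_left_injective k).hasSum_iff]
  · simpa [Function.comp_def, add_assoc] using h
  · intro i hi
    have : i < k := by
      by_contra! hle
      exact hi ⟨i - k, Nat.sub_add_cancel hle⟩
    rw [Nat.choose_eq_zero_of_lt (by omega)]
    simp

theorem hasSum_one_sub_mul_choose_mul_pow {b : ℝ} (hb0 : 0 ≤ b) (hb1 : b < 1) {m : ℕ}
    (hm : 1 ≤ m) :
    HasSum (fun j : ℕ => (1 - b) * (((j + m).choose m : ℝ) * b ^ (j + m - 1)))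
      (b ^ (m - 1) / (1 - b) ^ m) := by
  have h := (hasSum_choose_mul_geometric_of_norm_lt_one m
    (show ‖b‖ < 1 by rwa [Real.norm_of_nonneg hb0])).mul_left ((1 - b) * b ^ (m - 1))
  have hne : 1 - b ≠ 0 := by linarith
  convert! h using 1
  · ext j
    rw [Nat.add_sub_assoc hm, pow_add]
    ring
  · field_simp
    ring

theorem pow_div_one_sub_pow_le_two {b : ℝ} (hb0 : 0 ≤ b) (hb : b ≤ 1 / 2) {m : ℕ} (hm : 1 ≤ m) :
    b ^ (m - 1) / (1 - b) ^ m ≤ 2 := by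
  obtain ⟨n, rfl⟩ := Nat.exists_eq_add_of_le' hm
  have hpos : 0 < 1 - b := by linarith
  rw [div_le_iff₀ (by positivity), Nat.add_sub_cancel, pow_succ]
  have h1 : b ^ n ≤ (1 - b) ^ n := pow_le_pow_left₀ hb0 (by linarith) n
  have h2 : 0 ≤ (1 - b) ^ n := by positivity
  nlinarith

/-- If `q_j = Σ_k (-1)^k y_k β_k^{j-1} (1-β_k)`, then the `m`-th normalized factorial moment of `q`
is the absolutely convergent series `Σ_k (-1)^k y_k β_k^{m-1}/(1-β_k)^m`. -/
theorem factorial_moment_of_alternating_geometric_mixture {β y q : ℕ → ℝ}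
    (hβ : ∀ k, 0 < β k ∧ β k < 1 / 2) (hy0 : ∀ k, 0 ≤ y k) (hysum : Summable y)
    (hq : ∀ j, 1 ≤ j →
      HasSum (fun k => y k * ((-1) ^ k * β k ^ (j - 1) * (1 - β k))) (q j))
    {m : ℕ} (hm : 1 ≤ m) :
    Summable (fun k : ℕ => |(-1 : ℝ) ^ k * y k * β k ^ (m - 1) / (1 - β k) ^ m|) ∧
      ∑' i : ℕ, ((i + m).choose m : ℝ) * q (i + m) =
        ∑' k : ℕ, (-1 : ℝ) ^ k * y k * β k ^ (m - 1) / (1 - β k) ^ m := by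
  have hrow (k : ℕ) := hasSum_one_sub_mul_choose_mul_pow (hβ k).1.le
    (by linarith [(hβ k).2]) hm
  have hb1 (k : ℕ) : 0 ≤ 1 - β k := by linarith [(hβ k).2]
  have hratio (k : ℕ) : 0 ≤ β k ^ (m - 1) / (1 - β k) ^ m :=
    div_nonneg (pow_nonneg (hβ k).1.le _) (pow_nonneg (hb1 k) _)
  have hyratio : Summable fun k => y k * (β k ^ (m - 1) / (1 - β k) ^ m) :=
    (hysum.mul_right 2).of_nonneg_of_le (fun k => mul_nonneg (hy0 k) (hratio k)) fun k =>
      mul_le_mul_of_nonneg_left (pow_div_one_sub_pow_le_two (hβ k).1.le (hβ k).2.le hm) (hy0 k)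
  have habs (k : ℕ) : |(-1:ℝ) ^ k * y k * β k ^ (m-1) / (1 - β k) ^ m| =
      y k * (β k ^ (m - 1) / (1 - β k) ^ m) := by
    rw [mul_assoc, mul_div_assoc, mul_div_assoc, abs_mul, abs_pow, abs_neg, abs_one, one_pow,
      one_mul, abs_of_nonneg (mul_nonneg (hy0 k) (hratio k))]
  have hsum : Summable fun k : ℕ =>
      |(-1:ℝ) ^ k * y k * β k ^ (m-1) / (1 - β k) ^ m| := by
    simpa only [habs] using hyratio
  refine ⟨hsum, ?_⟩
  have hH0 (p : ℕ × ℕ) : 0 ≤ y p.1 *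
      ((1 - β p.1) * (((p.2 + m).choose m : ℝ) * β p.1 ^ (p.2 + m - 1))) :=
    mul_nonneg (hy0 _) (mul_nonneg (hb1 _)
      (mul_nonneg (Nat.cast_nonneg _) (pow_nonneg (hβ _).1.le _)))
  have hH : Summable fun p : ℕ × ℕ => y p.1 *
      ((1 - β p.1) * (((p.2 + m).choose m : ℝ) * β p.1 ^ (p.2 + m - 1))) := by
    refine (summable_prod_of_nonneg hH0).mpr ⟨fun k => ?_, ?_⟩
    · exact (hrow k).summable.mul_left (y k)
    · simpa only [tsum_mul_left, (hrow _).tsum_eq] using hyratio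
  have hG : Summable fun p : ℕ × ℕ => (-1 : ℝ) ^ p.1 * (y p.1 *
      ((1 - β p.1) * (((p.2 + m).choose m : ℝ) * β p.1 ^ (p.2 + m - 1)))) :=
    hH.of_norm_bounded fun p => by
      rw [norm_mul, norm_pow, norm_neg, norm_one, one_pow, one_mul, Real.norm_of_nonneg (hH0 p)]
  have hGcol (j : ℕ) : HasSum (fun k : ℕ => (-1 : ℝ) ^ k * (y k *
      ((1 - β k) * (((j + m).choose m : ℝ) * β k ^ (j + m - 1)))))
      (((j + m).choose m : ℝ) * q (j + m)) := by
    convert! (hq (j + m) (by omega)).mul_left ((j + m).choose m : ℝ) using 1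
    ext k
    ring
  have hGsum : HasSum
      (fun k => (-1 : ℝ) ^ k * (y k * (β k ^ (m - 1) / (1 - β k) ^ m)))
      (∑' k : ℕ, (-1:ℝ) ^ k * y k * β k ^ (m-1) / (1 - β k) ^ m) := by
    simpa only [mul_div_assoc, mul_assoc] using hsum.of_abs.hasSum
  exact (hasSum_swap_of_summable hG (fun k => ((hrow k).mul_left _).mul_left _) hGcol hGsum).tsum_eq

theorem stmt_17
    (b : ℕ → ℝ) (hb0 : b 0 = 1) (hb : ∀ k, 1 ≤ k → 0 < b k ∧ b k < 1/2)
    (P : ℕ → ℕ → ℝ)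
    (hP : ∀ i j : ℕ, 1 ≤ i → 1 ≤ j →
      P i j = ∑ k ∈ Finset.range (i+1), (i.choose k : ℝ) * (-1) ^ k * b k ^ (j-1) * (b k - 1))
    (π : ℕ → ℝ) (hπ_nonneg : ∀ i, 0 ≤ π i)
    (hπ_sum : HasSum (fun i : ℕ => π (i+1)) 1)
    (hπ_2 : Summable (fun i : ℕ => π (i+1) * 2 ^ (i+1)))
    (hπ_inv : ∀ j : ℕ, 1 ≤ j → HasSum (fun i : ℕ => π (i+1) * P (i+1) j) (π j))
    (x : ℕ → ℝ) (hx : ∀ k, 1 ≤ k → x k = ∑' i : ℕ, (((i+k).choose k : ℝ)) * π (i+k)) :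
    ∀ m : ℕ, 1 ≤ m →
      Summable (fun k : ℕ =>
        |(-1:ℝ) ^ k * x (k+1) * b (k+1) ^ (m-1) / (1 - b (k+1)) ^ m|) ∧
      x m = ∑' k : ℕ, (-1:ℝ) ^ k * x (k+1) * b (k+1) ^ (m-1) / (1 - b (k+1)) ^ m := by
  have hbk (k : ℕ) : 0 < b (k + 1) ∧ b (k + 1) < 1 / 2 := hb (k + 1) (by omega)
  have hF := summable_choose_mul hπ_nonneg hπ_2
  have hxs (k : ℕ) :
      HasSum (fun i => ((i + (k + 1)).choose (k + 1) : ℝ) * π (i + (k + 1))) (x (k + 1)) := by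
    rw [hx _ (by omega)]
    have h := (summable_nat_add_iff k).mpr (hF.prod_symm.prod_factor k)
    exact (by simpa [add_assoc] using h : Summable _).hasSum
  have hcol (k : ℕ) := hasSum_choose_mul_succ (hxs k)
  have hx0 (k : ℕ) : 0 ≤ x (k + 1) :=
    (hxs k).nonneg fun i => mul_nonneg (Nat.cast_nonneg _) (hπ_nonneg _)
  have hxsum : Summable fun k => x (k + 1) :=
    (hF.prod_symm.hasSum.prod_fiberwise hcol).summable
  have hπ_eq (j : ℕ) (hj : 1 ≤ j) :
      HasSum (fun k => x (k + 1) * ((-1) ^ k * b (k + 1) ^ (j - 1) * (1 - b (k + 1)))) (π j) := by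
    refine hasSum_swap_of_summable (f := fun p => ((p.1 + 1).choose (p.2 + 1) : ℝ) * π (p.1 + 1) *
      ((-1) ^ p.2 * b (p.2 + 1) ^ (j - 1) * (1 - b (p.2 + 1)))) ?_ (fun i => ?_)
      (fun k => (hcol k).mul_right _) (hπ_inv j hj)
    · refine hF.of_norm_bounded fun p => ?_
      obtain ⟨h0, h1⟩ := hbk p.2
      have hpow : b (p.2 + 1) ^ (j - 1) ≤ 1 := pow_le_one₀ h0.le (by linarith)
      rw [norm_mul, Real.norm_of_nonneg (mul_nonneg (Nat.cast_nonneg _) (hπ_nonneg _))]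
      refine mul_le_of_le_one_right (mul_nonneg (Nat.cast_nonneg _) (hπ_nonneg _)) ?_
      rw [norm_mul, norm_mul, norm_pow, norm_neg, norm_one, one_pow, one_mul,
        Real.norm_of_nonneg (pow_nonneg h0.le _), Real.norm_of_nonneg (by linarith)]
      exact mul_le_one₀ hpow (by linarith) (by linarith)
    · rw [hP _ _ (by omega) hj, Finset.sum_range_succ', hb0, sub_self, mul_zero, add_zero,
        Finset.mul_sum]
      rw [show ∑ k ∈ Finset.range (i + 1), π (i + 1) * (((i + 1).choose (k + 1) : ℝ) *
          (-1) ^ (k + 1) * b (k + 1) ^ (j - 1) * (b (k + 1) - 1)) =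
          ∑ k ∈ Finset.range (i + 1), ((i + 1).choose (k + 1) : ℝ) * π (i + 1) *
            ((-1) ^ k * b (k + 1) ^ (j - 1) * (1 - b (k + 1)))
        from Finset.sum_congr rfl fun k _ => by ring]
      refine hasSum_sum_of_ne_finset_zero fun k hk => ?_
      rw [Nat.choose_eq_zero_of_lt (by simpa using hk)]
      simp
  intro m hm
  rw [hx m hm]
  exact factorial_moment_of_alternating_geometric_mixture hbk hx0 hxsum hπ_eq hm
end

section
/- For every i ≥ 1, π_i = Σ_{k=1}^∞ (−1)^{k−1} x_k (1−b_k) b_k^{i−1}, the series converging absolutely; i.e., the stationary distribution is an alternating mixture of geometric probabilities. -/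
/-- The family `a m * C(m+1, k+1)` is summable over pairs as soon as `a m * 2^(m+1)` is. -/
theorem summable_mul_choose_succ {a : ℕ → ℝ} (ha : ∀ m, 0 ≤ a m)
    (h : Summable fun m => a m * 2 ^ (m + 1)) :
    Summable fun p : ℕ × ℕ => a p.1 * ((p.1 + 1).choose (p.2 + 1) : ℝ) := by
  have hfin : ∀ m, HasSum (fun k : ℕ => a m * ((m + 1).choose (k + 1) : ℝ))
      (∑ k ∈ Finset.range (m + 1), a m * ((m + 1).choose (k + 1) : ℝ)) := fun m =>
    hasSum_sum_of_ne_finset_zero fun k hk => by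
      rw [Finset.mem_range, not_lt] at hk
      simp [Nat.choose_eq_zero_of_lt (show m + 1 < k + 1 by omega)]
  refine (summable_prod_of_nonneg fun p => mul_nonneg (ha _) (Nat.cast_nonneg _)).2
    ⟨fun m => (hfin m).summable, ?_⟩
  refine h.of_nonneg_of_le (fun m => tsum_nonneg fun k => mul_nonneg (ha _) (Nat.cast_nonneg _))
    fun m => ?_
  rw [(hfin m).tsum_eq, ← Finset.mul_sum]
  refine mul_le_mul_of_nonneg_left ?_ (ha m)
  have hsum := Nat.sum_range_choose (m + 1)
  rw [Finset.sum_range_succ'] at hsum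
  exact_mod_cast (Nat.le_add_right _ _).trans hsum.le

/-- The lower terms `m < k` of a sum against `C(m+1, k+1)` vanish. -/
theorem tsum_mul_choose_succ_eq_tsum_add {a : ℕ → ℝ} (k : ℕ)
    (h : Summable fun m => a (m + 1) * ((m + 1).choose (k + 1) : ℝ)) :
    ∑' m, a (m + 1) * ((m + 1).choose (k + 1) : ℝ) =
      ∑' i, ((i + (k + 1)).choose (k + 1) : ℝ) * a (i + (k + 1)) := by
  rw [← h.sum_add_tsum_nat_add k, Finset.sum_eq_zero, zero_add]
  · exact tsum_congr fun i => mul_comm _ _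
  · intro m hm
    rw [Finset.mem_range] at hm
    simp [Nat.choose_eq_zero_of_lt (show m + 1 < k + 1 by omega)]

/-- The stationary distribution of the number of customers served per stage in the
gated GI/M/∞ queue is an alternating mixture of geometric probabilities: for every
`i ≥ 1`, `π_i = Σ_{k=1}^∞ (−1)^{k−1} x_k (1−b_k) b_k^{i−1}`, the series converging
absolutely. -/
theorem stmt_18
    (b : ℕ → ℝ) (hb0 : b 0 = 1) (hb : ∀ k, 1 ≤ k → 0 < b k ∧ b k < 1/2)
    (P : ℕ → ℕ → ℝ)
    (hP : ∀ i j : ℕ, 1 ≤ i → 1 ≤ j →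
      P i j = ∑ k ∈ Finset.range (i+1), (i.choose k : ℝ) * (-1) ^ k * b k ^ (j-1) * (b k - 1))
    (π : ℕ → ℝ) (hπ_nonneg : ∀ i, 0 ≤ π i)
    (hπ_sum : HasSum (fun i : ℕ => π (i+1)) 1)
    (hπ_2 : Summable (fun i : ℕ => π (i+1) * 2 ^ (i+1)))
    (hπ_inv : ∀ j : ℕ, 1 ≤ j → HasSum (fun i : ℕ => π (i+1) * P (i+1) j) (π j))
    (x : ℕ → ℝ) (hx : ∀ k, 1 ≤ k → x k = ∑' i : ℕ, (((i+k).choose k : ℝ)) * π (i+k)) :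
    ∀ i : ℕ, 1 ≤ i →
      Summable (fun k : ℕ =>
        |(-1:ℝ) ^ k * x (k+1) * (1 - b (k+1)) * b (k+1) ^ (i-1)|) ∧
      π i = ∑' k : ℕ, (-1:ℝ) ^ k * x (k+1) * (1 - b (k+1)) * b (k+1) ^ (i-1) := by
  intro i hi
  have hH := summable_mul_choose_succ (a := fun m => π (m + 1)) (fun m => hπ_nonneg _) hπ_2
  set c : ℕ → ℝ := fun k => (-1) ^ k * (1 - b (k + 1)) * b (k + 1) ^ (i - 1) with hc
  have hc_le : ∀ k, |c k| ≤ 1 := fun k => by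
    obtain ⟨h0, h1⟩ := hb (k + 1) (by omega)
    rw [hc]
    simp only [abs_mul, abs_pow, abs_neg, abs_one, one_pow, one_mul]
    rw [abs_of_pos h0, abs_of_pos (by linarith : 0 < 1 - b (k + 1))]
    exact mul_le_one₀ (by linarith) (by positivity) (pow_le_one₀ h0.le (by linarith))
  have hG : Summable fun p : ℕ × ℕ =>
      π (p.1 + 1) * ((p.1 + 1).choose (p.2 + 1) : ℝ) * c p.2 := by
    refine hH.of_norm_bounded fun p => ?_
    have hnn : 0 ≤ π (p.1 + 1) * ((p.1 + 1).choose (p.2 + 1) : ℝ) :=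
      mul_nonneg (hπ_nonneg _) (Nat.cast_nonneg _)
    rw [Real.norm_eq_abs, abs_mul, abs_of_nonneg hnn]
    exact mul_le_of_le_one_right hnn (hc_le _)
  have hcol : ∀ k, ∑' m, π (m + 1) * ((m + 1).choose (k + 1) : ℝ) * c k =
      (-1 : ℝ) ^ k * x (k + 1) * (1 - b (k + 1)) * b (k + 1) ^ (i - 1) := fun k => by
    rw [tsum_mul_right, tsum_mul_choose_succ_eq_tsum_add k (hH.prod_symm.prod_factor k),
      ← hx (k + 1) (by omega), hc]
    ring
  have hrow : ∀ m, ∑' k, π (m + 1) * ((m + 1).choose (k + 1) : ℝ) * c k =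
      π (m + 1) * P (m + 1) i := fun m => by
    rw [tsum_eq_sum (s := Finset.range (m + 1)), hP _ _ (by omega) hi,
      Finset.sum_range_succ' _ (m + 1), hb0, sub_self, mul_zero, add_zero, Finset.mul_sum]
    · refine Finset.sum_congr rfl fun k _ => ?_
      rw [hc]
      ring
    · intro k hk
      rw [Finset.mem_range, not_lt] at hk
      simp [Nat.choose_eq_zero_of_lt (show m + 1 < k + 1 by omega)]
  refine ⟨(hG.prod_symm.prod.congr fun k => hcol k).abs, ?_⟩
  rw [← (hπ_inv i hi).tsum_eq, ← tsum_congr hrow, ← tsum_congr hcol]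
  exact hG.prod_symm.tsum_comm
end
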